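/- arXiv:2407.19230 — 2 statements merged into one kernel-verified Lean document; each statement's English description precedes it below -/
import Mathlib

section
/- Let p be a prime number with p ≡ 1 (mod 24) and suppose B_{11,2}( 11(p−1)/24 ) ≡ 0 (mod 11). Then for every nonnegative integer α and every nonnegative integer n with p ∤ (24n + 11), we have B_{11,2}( p^{2α+1} n + 11(p^{2α+1} − 1)/24 ) ≡ 0 (mod 11). -/
/-- The number of `t`-regular partitions of `n`, i.e. partitions of `n`
none of whose parts is divisible by `t`. -/
noncomputable def regularPartitionCount (t n : ℕ) : ℕ :=
  Nat.card {π : n.Partition // ∀ x ∈ π.parts, ¬ t ∣ x}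

/-- `B u v n` is the number of `(u,v)`-regular bipartitions of `n`: pairs `(α, β)` of
partitions with `|α| + |β| = n`, `α` being `u`-regular and `β` being `v`-regular. -/
noncomputable def B (u v n : ℕ) : ℕ :=
  ∑ i ∈ Finset.range (n + 1), regularPartitionCount u i * regularPartitionCount v (n - i)

open PowerSeries PowerSeries.WithPiTopology in
/-- The product of the generating function of `m`-regular partitions with Euler's function. -/
theorem mk_card_restricted_mul_pentagonalSeries (R : Type*) [CommRing R] [NoZeroDivisors R]
    {m : ℕ} (hm : m ≠ 0) :
    PowerSeries.mk (fun n ↦ ((Nat.Partition.restricted n (¬ m ∣ ·)).card : R)) *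
      pentagonalSeries R = expand m hm (pentagonalSeries R) := by
  let _ : TopologicalSpace R := ⊥
  have : DiscreteTopology R := ⟨rfl⟩
  have hm' : 0 < m := Nat.pos_of_ne_zero hm
  rw [Nat.Partition.powerSeriesMk_card_restricted_eq_powerSeriesMk_card_countRestricted R hm']
  have h := (Nat.Partition.hasProd_powerSeriesMk_card_countRestricted R hm').mul
    (hasProd_one_sub_X_pow R)
  refine h.unique ?_
  rw [HasProd, tendsto_iff_coeff_tendsto]
  intro d
  apply tendsto_nhds_of_eventually_eq
  have hp (s : Finset ℕ) : ∏ b ∈ s, (∑ j ∈ Finset.range m, (X : R⟦X⟧) ^ ((b + 1) * j)) *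
      (1 - X ^ (b + 1)) = expand m hm (∏ b ∈ s, (1 - X ^ (b + 1))) := by
    rw [map_prod]
    refine Finset.prod_congr rfl fun b _ ↦ ?_
    simp_rw [pow_mul]
    rw [geom_sum_mul_neg]
    simp [← pow_mul, mul_comm]
  simp only [hp, coeff_expand]
  split_ifs with hd
  · simpa using coeff_prod_one_sub_X_pow_eventually_eq R (d / m)
  · simp

theorem regularPartitionCount_eq_card_restricted (t n : ℕ) :
    regularPartitionCount t n = (Nat.Partition.restricted n (¬ t ∣ ·)).card := by
  rw [regularPartitionCount, Nat.card_eq_fintype_card, Fintype.card_subtype,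
    Nat.Partition.restricted]

open PowerSeries in
theorem map_pentagonalSeries {R S : Type*} [CommRing R] [CommRing S] (f : R →+* S) :
    (pentagonalSeries R).map f = pentagonalSeries S := by
  ext n
  rw [coeff_map]
  by_cases hn : n ∈ Set.range pentagonal
  · obtain ⟨k, rfl⟩ := hn
    simp
  · simp [coeff_pentagonalSeries_eq_zero _ hn]

open PowerSeries in
/-- The power series `∏ (1 - X ^ n) ^ 9 * (1 - X ^ (2 * n))`. -/
noncomputable def eulerProd : ℤ⟦X⟧ :=
  pentagonalSeries ℤ ^ 9 * expand 2 two_ne_zero (pentagonalSeries ℤ)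

open PowerSeries in
theorem B_eleven_two_eq_coeff (n : ℕ) : (B 11 2 n : ZMod 11) = (eulerProd.coeff n : ℤ) := by
  have : Fact (Nat.Prime 11) := ⟨by norm_num⟩
  set φ := pentagonalSeries (ZMod 11)
  have h11 := mk_card_restricted_mul_pentagonalSeries (ZMod 11) (m := 11) (by norm_num)
  have h2 := mk_card_restricted_mul_pentagonalSeries (ZMod 11) (m := 2) (by norm_num)
  have hfrob : expand 11 (by norm_num) φ = φ ^ 11 := by
    have := MvPowerSeries.map_frobenius_expand (p := 11) (hp := by norm_num) (f := φ)
    rw [ZMod.frobenius_zmod] at this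
    rw [← this]
    exact (congrFun (congrArg DFunLike.coe (MvPowerSeries.map_id)) _).symm
  rw [hfrob] at h11
  have hφ : φ ≠ 0 := by
    intro h
    have : φ.coeff (pentagonal 0) = 1 := by simp [φ]
    simp [h] at this
  have key : PowerSeries.mk (fun n ↦ ((Nat.Partition.restricted n (¬ 11 ∣ ·)).card : ZMod 11)) *
      PowerSeries.mk (fun n ↦ ((Nat.Partition.restricted n (¬ 2 ∣ ·)).card : ZMod 11)) =
      φ ^ 9 * expand 2 two_ne_zero φ := by
    apply mul_right_cancel₀ (pow_ne_zero 2 hφ)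
    linear_combination h11 * (PowerSeries.mk
      (fun n ↦ ((Nat.Partition.restricted n (¬ 2 ∣ ·)).card : ZMod 11)) * φ) + φ ^ 11 * h2
  have hmap : eulerProd.map (Int.castRingHom (ZMod 11)) = φ ^ 9 * expand 2 two_ne_zero φ := by
    simp [eulerProd, map_expand, map_pentagonalSeries, φ]
  have := congrArg (coeff n) (key.trans hmap.symm)
  rw [coeff_mul, Finset.Nat.sum_antidiagonal_eq_sum_range_succ_mk] at this
  simpa [B, regularPartitionCount_eq_card_restricted] using this

/-- Euler's function `∏ (1 - q ^ (n + 1))`. -/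
noncomputable def eulerFun (q : ℂ) : ℂ := ∏' n : ℕ, (1 - q ^ (n + 1))

open PowerSeries in
theorem abs_coeff_prod_one_sub_X_pow_le {r : ℝ} (hr : 0 ≤ r) (N n : ℕ) :
    |((∏ i ∈ Finset.range N, (1 - X ^ (i + 1) : ℤ⟦X⟧)).coeff n : ℝ)| * r ^ n ≤
      ∏ i ∈ Finset.range N, (1 + r ^ (i + 1)) := by
  induction N generalizing n with
  | zero =>
    by_cases hn : n = 0
    · simp [hn]
    · simp [coeff_one, hn]
  | succ N ih =>
    rw [Finset.prod_range_succ, Finset.prod_range_succ, mul_sub, mul_one, map_sub, coeff_mul_X_pow',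
      mul_add, mul_one]
    have h0 : 0 ≤ ∏ i ∈ Finset.range N, (1 + r ^ (i + 1)) :=
      Finset.prod_nonneg fun i _ ↦ by positivity
    split_ifs with h
    · have h1 := ih n
      have h2 := ih (n - (N + 1))
      push_cast
      have h3 : r ^ n = r ^ (n - (N + 1)) * r ^ (N + 1) := by rw [← pow_add]; congr 1; omega
      refine (mul_le_mul_of_nonneg_right (abs_sub _ _) (by positivity)).trans ?_
      rw [add_mul]
      refine add_le_add h1 ?_
      rw [h3, ← mul_assoc]
      exact mul_le_mul_of_nonneg_right h2 (by positivity)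
    · simp only [sub_zero]
      exact (ih n).trans (le_add_of_nonneg_right (by positivity))

theorem prod_one_add_pow_le {r : ℝ} (hr : 0 ≤ r) (hr1 : r < 1) (N : ℕ) :
    ∏ i ∈ Finset.range N, (1 + r ^ (i + 1)) ≤ Real.exp (1 / (1 - r)) := by
  calc ∏ i ∈ Finset.range N, (1 + r ^ (i + 1))
      ≤ ∏ i ∈ Finset.range N, Real.exp (r ^ (i + 1)) :=
        Finset.prod_le_prod (fun i _ ↦ by positivity)
          fun i _ ↦ by rw [add_comm]; exact Real.add_one_le_exp _
    _ = Real.exp (∑ i ∈ Finset.range N, r ^ (i + 1)) := (Real.exp_sum _ _).symm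
    _ ≤ Real.exp (1 / (1 - r)) := by
        apply Real.exp_le_exp.mpr
        rw [one_div, ← tsum_geometric_of_lt_one hr hr1]
        refine (Finset.sum_le_sum fun i _ ↦ ?_).trans
          ((summable_geometric_of_lt_one hr hr1).sum_le_tsum (Finset.range N)
            fun i _ ↦ by positivity)
        exact pow_le_pow_of_le_one hr hr1.le (Nat.le_succ i)

open PowerSeries Filter Topology in
/-- Euler's function is the sum of its formal expansion. -/
theorem hasSum_pentagonalSeries_eulerFun {q : ℂ} (hq : ‖q‖ < 1) :
    HasSum (fun n ↦ ((pentagonalSeries ℤ).coeff n : ℂ) * q ^ n) (eulerFun q) := by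
  obtain ⟨r, hqr, hr1⟩ := exists_between hq
  have hr0 : 0 < r := (norm_nonneg q).trans_lt hqr
  set M := Real.exp (1 / (1 - r))
  let c (N n : ℕ) : ℤ := (∏ i ∈ Finset.range N, (1 - X ^ (i + 1) : ℤ⟦X⟧)).coeff n
  have hbound (N n : ℕ) : ‖(c N n : ℂ) * q ^ n‖ ≤ M * (‖q‖ / r) ^ n := by
    have h1 := (abs_coeff_prod_one_sub_X_pow_le hr0.le N n).trans (prod_one_add_pow_le hr0.le hr1 N)
    rw [norm_mul, norm_pow, div_pow, Complex.norm_intCast, ← mul_div_assoc,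
      le_div_iff₀ (by positivity)]
    calc |(c N n : ℝ)| * ‖q‖ ^ n * r ^ n = (|(c N n : ℝ)| * r ^ n) * ‖q‖ ^ n := by ring
      _ ≤ M * ‖q‖ ^ n := mul_le_mul_of_nonneg_right h1 (by positivity)
  have hsumb : Summable fun n ↦ M * (‖q‖ / r) ^ n :=
    (summable_geometric_of_lt_one (by positivity) ((div_lt_one hr0).mpr hqr)).mul_left M
  have hev (n : ℕ) : ∀ᶠ N in atTop, c N n = (pentagonalSeries ℤ).coeff n := by
    have h := coeff_prod_one_sub_X_pow_eventually_eq ℤ n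
    exact tendsto_finset_range.eventually h
  have hlim := tendsto_tsum_of_dominated_convergence (𝓕 := atTop)
    (f := fun N n ↦ (c N n : ℂ) * q ^ n)
    (g := fun n ↦ ((pentagonalSeries ℤ).coeff n : ℂ) * q ^ n) hsumb
    (fun n ↦ tendsto_nhds_of_eventually_eq ((hev n).mono fun N h ↦ by simp only [h]))
    (Eventually.of_forall hbound)
  have hpoly (N : ℕ) : ∑' n, (c N n : ℂ) * q ^ n = ∏ i ∈ Finset.range N, (1 - q ^ (i + 1)) := by
    let P : Polynomial ℤ := ∏ i ∈ Finset.range N, (1 - Polynomial.X ^ (i + 1))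
    have hc (n : ℕ) : c N n = P.coeff n := by
      rw [← Polynomial.coeff_coe]
      have : (P : ℤ⟦X⟧) = Polynomial.coeToPowerSeries.ringHom P := rfl
      rw [this, map_prod]
      simp [c]
    rw [tsum_eq_sum (s := Finset.range (P.natDegree + 1))]
    · have : Polynomial.eval₂ (Int.castRingHom ℂ) q P = ∏ i ∈ Finset.range N, (1 - q ^ (i + 1)) := by
        simp [P, Polynomial.eval₂_finsetProd]
      rw [← this, Polynomial.eval₂_eq_sum_range]
      simp [hc]
    · intro n hn
      rw [hc, Polynomial.coeff_eq_zero_of_natDegree_lt (by simpa using hn)]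
      simp
  have hprod := (ModularForm.multipliable_one_sub_pow hq).hasProd.tendsto_prod_nat
  simp_rw [hpoly] at hlim
  rw [show eulerFun q = _ from tendsto_nhds_unique hprod hlim]
  refine (Summable.of_norm_bounded hsumb fun n ↦ ?_).hasSum
  obtain ⟨N, hN⟩ := (hev n).exists
  rw [← hN]
  exact hbound N n

open PowerSeries in
/-- An integral power series converges on the unit disc to a given function. -/
def ConvergesTo (f : ℤ⟦X⟧) (F : ℂ → ℂ) : Prop :=
  ∀ q : ℂ, ‖q‖ < 1 → HasSum (fun n ↦ (f.coeff n : ℂ) * q ^ n) (F q)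

namespace ConvergesTo

open PowerSeries

variable {f g : ℤ⟦X⟧} {F G : ℂ → ℂ}

theorem mul (hf : ConvergesTo f F) (hg : ConvergesTo g G) :
    ConvergesTo (f * g) (fun q ↦ F q * G q) := by
  intro q hq
  have h1 := (hf q hq).summable.norm
  have h2 := (hg q hq).summable.norm
  have h3 := (summable_norm_sum_mul_antidiagonal_of_summable_norm h1 h2).of_norm.hasSum
  rw [← tsum_mul_tsum_eq_tsum_sum_antidiagonal_of_summable_norm h1 h2, (hf q hq).tsum_eq,
    (hg q hq).tsum_eq] at h3
  refine (congrArg (HasSum · _) (funext fun n ↦ ?_)).mpr h3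
  rw [coeff_mul, Int.cast_sum, Finset.sum_mul]
  refine Finset.sum_congr rfl fun x hx ↦ ?_
  rw [← Finset.HasAntidiagonal.mem_antidiagonal.mp hx]
  push_cast
  ring

theorem one : ConvergesTo 1 (fun _ ↦ 1) := by
  intro q _
  convert hasSum_ite_eq 0 (1 : ℂ) using 2 with n
  by_cases hn : n = 0
  · simp [hn]
  · simp [coeff_one, hn]

theorem pow (hf : ConvergesTo f F) (k : ℕ) : ConvergesTo (f ^ k) (fun q ↦ F q ^ k) := by
  induction k with
  | zero => simpa using one
  | succ k ih => simpa only [pow_succ] using ih.mul hf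

theorem expand (hf : ConvergesTo f F) {m : ℕ} (hm : m ≠ 0) :
    ConvergesTo (PowerSeries.expand m hm f) (fun q ↦ F (q ^ m)) := by
  intro q hq
  have h := hf (q ^ m) (by rw [norm_pow]; exact pow_lt_one₀ (norm_nonneg _) hq hm)
  rw [← (mul_right_injective₀ hm).hasSum_iff]
  · simpa [Function.comp_def, pow_mul] using h
  · intro n hn
    rw [coeff_expand_of_not_dvd]
    · simp
    · rintro ⟨k, rfl⟩
      exact hn ⟨k, rfl⟩

end ConvergesTo

open PowerSeries in
theorem convergesTo_eulerProd :
    ConvergesTo eulerProd (fun q ↦ eulerFun q ^ 9 * eulerFun (q ^ 2)) :=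
  ConvergesTo.mul (ConvergesTo.pow (fun _ ↦ hasSum_pentagonalSeries_eulerFun) 9)
    (ConvergesTo.expand (fun _ ↦ hasSum_pentagonalSeries_eulerFun) two_ne_zero)

open PowerSeries in
/-- The power series `∏ (1 - X ^ (2 * n)) ^ 9 * (1 - X ^ n)`. -/
noncomputable def eulerProdDual : ℤ⟦X⟧ :=
  expand 2 two_ne_zero (pentagonalSeries ℤ) ^ 9 * pentagonalSeries ℤ

theorem convergesTo_eulerProdDual :
    ConvergesTo eulerProdDual (fun q ↦ eulerFun (q ^ 2) ^ 9 * eulerFun q) :=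
  ConvergesTo.mul (ConvergesTo.pow
    (ConvergesTo.expand (fun _ ↦ hasSum_pentagonalSeries_eulerFun) two_ne_zero) 9)
    (fun _ ↦ hasSum_pentagonalSeries_eulerFun)

open Complex ModularForm in
/-- The eta product `η(z) ^ 9 * η(2 * z)`. -/
noncomputable def etaProd (z : ℂ) : ℂ := η z ^ 9 * η (2 * z)

open Complex ModularForm in
/-- The eta product `η(z) ^ 9 * η(z / 2)`, the image of `etaProd` under `z ↦ -1 / z`. -/
noncomputable def etaProdDual (z : ℂ) : ℂ := η z ^ 9 * η (z / 2)

open Complex in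
/-- The uniformizer `exp(2 * π * i * z / 48)`. -/
noncomputable def expParam (z : ℂ) : ℂ := cexp (2 * Real.pi * I * z / 48)

open Complex in
theorem expParam_add (z w : ℂ) : expParam (z + w) = expParam z * expParam w := by
  rw [expParam, expParam, expParam, ← exp_add]
  congr 1
  ring

open Complex in
theorem expParam_nat_mul (n : ℕ) (z : ℂ) : expParam (n * z) = expParam z ^ n := by
  rw [expParam, expParam, ← Complex.exp_nat_mul]
  congr 1
  ring

open Complex in
theorem expParam_ne_zero (z : ℂ) : expParam z ≠ 0 := exp_ne_zero _

open Complex in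
theorem expParam_forty_eight_mul_int (n : ℤ) : expParam (48 * n) = 1 := by
  rw [expParam, Complex.exp_eq_one_iff]
  exact ⟨n, by ring⟩

theorem expParam_one_pow : expParam 1 ^ 48 = 1 := by
  simpa [← expParam_nat_mul] using expParam_forty_eight_mul_int 1

theorem expParam_int_congr {m n : ℤ} (h : m ≡ n [ZMOD 48]) : expParam m = expParam n := by
  obtain ⟨k, hk⟩ := h.symm.dvd
  have : (m : ℂ) = n + 48 * k := by exact_mod_cast (by linarith : m = n + 48 * k)
  rw [this, expParam_add, expParam_forty_eight_mul_int, mul_one]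

open Complex in
theorem norm_expParam_lt_one {z : ℂ} (hz : 0 < z.im) : ‖expParam z‖ < 1 := by
  rw [expParam, Complex.norm_exp, Real.exp_lt_one_iff]
  have : (2 * Real.pi * I * z / 48).re = - (2 * Real.pi * z.im / 48) := by
    simp [Complex.mul_re, Complex.mul_im]
    ring
  rw [this]
  have := Real.pi_pos
  have : 0 < 2 * Real.pi * z.im / 48 := by positivity
  linarith

open Complex ModularForm in
theorem eta_eq_expParam (z : ℂ) : η z = expParam z ^ 2 * eulerFun (expParam z ^ 48) := by
  rw [ModularForm.eta, eulerFun, ← expParam_nat_mul, ← expParam_nat_mul]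
  congr 1
  · rw [expParam, Function.Periodic.qParam]
    congr 1
    push_cast
    ring
  · have h : Function.Periodic.qParam 1 z = expParam ((48 : ℕ) * z) := by
      rw [expParam, Function.Periodic.qParam]
      congr 1
      push_cast
      ring
    simp only [eta_q, h]

theorem etaProd_eq (z : ℂ) : etaProd z = expParam z ^ 22 *
    (eulerFun (expParam z ^ 48) ^ 9 * eulerFun ((expParam z ^ 48) ^ 2)) := by
  have h : expParam (2 * z) = expParam z ^ 2 := by simpa using expParam_nat_mul 2 z
  rw [etaProd, eta_eq_expParam, eta_eq_expParam, h]
  ring_nf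

theorem etaProdDual_eq (z : ℂ) : etaProdDual z = expParam z ^ 19 *
    (eulerFun ((expParam z ^ 24) ^ 2) ^ 9 * eulerFun (expParam z ^ 24)) := by
  have h : expParam z = expParam (z / 2) ^ 2 := by
    rw [← expParam_nat_mul]
    congr 1
    push_cast
    ring
  rw [etaProdDual, eta_eq_expParam, eta_eq_expParam, h]
  ring_nf

theorem etaProd_add_int (z : ℂ) (k : ℤ) : etaProd (z + k) = expParam (22 * k) * etaProd z := by
  have h : expParam k ^ 48 = 1 := by
    rw [← expParam_nat_mul]; exact_mod_cast expParam_forty_eight_mul_int k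
  have h' : expParam (22 * k) = expParam k ^ 22 := by
    rw [← expParam_nat_mul]; norm_num
  rw [etaProd_eq, etaProd_eq, expParam_add, mul_pow _ _ 48, h, h', mul_one]
  ring

theorem etaProdDual_add_int (z : ℂ) (k : ℤ) :
    etaProdDual (z + 2 * k) = expParam (38 * k) * etaProdDual z := by
  have h : expParam (2 * k) ^ 24 = 1 := by
    rw [← expParam_nat_mul, ← expParam_forty_eight_mul_int k]; congr 1; push_cast; ring
  have h' : expParam (38 * k) = expParam (2 * k) ^ 19 := by
    rw [← expParam_nat_mul]; congr 1; push_cast; ring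
  rw [etaProdDual_eq, etaProdDual_eq, expParam_add, mul_pow _ _ 24, h, h', mul_one]
  ring

open Complex ModularForm in
theorem exists_etaProd_neg_one_div : ∃ κ : ℂ, κ ≠ 0 ∧
    ∀ z : ℂ, 0 < z.im → etaProd (-1 / z) = κ * z ^ 5 * etaProdDual z := by
  have hS {z : ℂ} (hz : 0 < z.im) : η (-1 / z) = (sqrt I)⁻¹ * (sqrt z * η z) := by
    simpa using eta_comp_eq_csqrt_I_inv hz
  have hsI : sqrt I ≠ 0 := by simp [sqrt]
  have hs2 : sqrt (2⁻¹ : ℂ) ≠ 0 := by simp [sqrt]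
  refine ⟨(sqrt I)⁻¹ ^ 10 * sqrt 2⁻¹, mul_ne_zero (pow_ne_zero _ (inv_ne_zero hsI)) hs2, ?_⟩
  intro z hz
  have hz2 : 0 < (z / 2).im := by
    simpa using! hz
  have h2 : 2 * (-1 / z) = -1 / (z / 2) := by
    field_simp
  have hsq : sqrt (z / 2) = sqrt z * sqrt 2⁻¹ := by
    have hz0 : z ≠ 0 := by rintro rfl; simp at hz
    have hlog : log (z / 2) = log z + log 2⁻¹ := by
      have := Complex.log_ofReal_mul (r := 2⁻¹) (by norm_num) hz0
      rw [Complex.ofReal_log (by norm_num), add_comm] at this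
      rw [div_eq_inv_mul]
      simpa using this
    rw [sqrt_eq_exp (by simpa using hz0), sqrt_eq_exp hz0, sqrt_eq_exp (by norm_num), hlog,
      ← exp_add]
    congr 1
    ring
  have hss : sqrt z ^ 2 = z := by
    simp [sqrt, ← Complex.cpow_nat_mul]
  rw [etaProd, etaProdDual, h2, hS hz, hS hz2, hsq]
  linear_combination ((sqrt I)⁻¹ ^ 10 * sqrt 2⁻¹ * η z ^ 9 * η (z / 2)) *
    (sqrt z ^ 8 + sqrt z ^ 6 * z + sqrt z ^ 4 * z ^ 2 + sqrt z ^ 2 * z ^ 3 + z ^ 4) * hss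

theorem intCast_mul_add_ne_zero {c d : ℤ} (h : c ≠ 0 ∨ d ≠ 0) {z : ℂ} (hz : 0 < z.im) :
    (c * z + d : ℂ) ≠ 0 := by
  intro h0
  have hi := congrArg Complex.im h0
  have hr := congrArg Complex.re h0
  simp [hz.ne'] at hi hr
  subst hi
  simp at hr
  simp [hr] at h

theorem im_moebius_pos {a b c d : ℤ} (h : 0 < a * d - b * c) {z : ℂ} (hz : 0 < z.im) :
    0 < ((a * z + b) / (c * z + d) : ℂ).im := by
  have hne : (c * z + d : ℂ) ≠ 0 := by
    refine intCast_mul_add_ne_zero ?_ hz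
    by_contra! hcd
    simp [hcd.1, hcd.2] at h
  have h' : (0 : ℝ) < a * d - b * c := by exact_mod_cast h
  have : ((a * z + b) / (c * z + d) : ℂ).im =
      (a * d - b * c) * z.im / Complex.normSq (c * z + d) := by
    simp [Complex.div_im]
    ring
  rw [this]
  exact div_pos (mul_pos h' hz) (Complex.normSq_pos.mpr hne)

/-- The action of lower triangular unipotent matrices on `etaProd`. -/
theorem etaProd_div_one_sub (k : ℤ) {w : ℂ} (hw : 0 < w.im) :
    etaProd (w / (1 - 2 * k * w)) = expParam (38 * k) * (1 - 2 * k * w) ^ 5 * etaProd w := by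
  obtain ⟨κ, -, h⟩ := exists_etaProd_neg_one_div
  have hw0 : w ≠ 0 := by rintro rfl; simp at hw
  have hu : 0 < (-1 / w).im := by
    simpa using im_moebius_pos (a := 0) (b := -1) (c := 1) (d := 0) (by norm_num) hw
  have hu' : 0 < (-1 / w + 2 * k).im := by
    simpa using! hu
  have hne : (1 - 2 * k * w : ℂ) ≠ 0 := by
    have := intCast_mul_add_ne_zero (c := -2 * k) (d := 1) (by simp) hw
    push_cast at this
    convert this using 1
    ring
  have h1 := h _ hu
  have h2 := h _ hu'
  have e1 : -1 / (-1 / w) = w := by field_simp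
  have e3 : (-1 / w + 2 * k) = (1 - 2 * k * w) * (-1 / w) := by field_simp; ring
  have e2 : -1 / (-1 / w + 2 * k) = w / (1 - 2 * k * w) := by
    rw [e3]
    field_simp
  rw [e1] at h1
  rw [e2, etaProdDual_add_int] at h2
  rw [h1, h2, e3]
  ring

/-- The exponent of the multiplier of `etaProd` on `Γ₀(2)`. -/
def multiplierExponent (a b c d : ℤ) : ℤ :=
  19 * c * (a + d) + b * d * (11 - 38 * c ^ 2) + 30 * (d - 1) - 57 * c * d +
    12 * (if (d : ZMod 8) = 3 ∨ (d : ZMod 8) = 5 then 1 else 0)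

theorem Int.modEq_twenty_four_of_zmod {m n : ℤ} (h8 : (m : ZMod 8) = n) (h3 : (m : ZMod 3) = n) :
    m ≡ n [ZMOD 24] := by
  have h8' := (ZMod.intCast_eq_intCast_iff m n 8).mp h8
  have h3' := (ZMod.intCast_eq_intCast_iff m n 3).mp h3
  simp only [Int.ModEq] at *
  push_cast at *
  omega

theorem multiplierExponent_add {a b c d : ℤ} (h : a * d - 2 * b * c = 1) :
    (∀ s : ℤ, s = 1 ∨ s = -1 → multiplierExponent (a + 2 * s * c) (b + s * d) c d ≡
      multiplierExponent a b c d + 11 * s [ZMOD 24]) ∧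
    ∀ s : ℤ, s = 1 ∨ s = -1 → multiplierExponent a b (c - s * a) (d - 2 * s * b) ≡
      multiplierExponent a b c d + 19 * s [ZMOD 24] := by
  have h8 : (a : ZMod 8) * d - 2 * b * c = 1 := by exact_mod_cast congrArg (Int.cast (R := ZMod 8)) h
  have h3 : (a : ZMod 3) * d - 2 * b * c = 1 := by exact_mod_cast congrArg (Int.cast (R := ZMod 3)) h
  have key8 : ∀ a b c d : ZMod 8, a * d - 2 * b * c = 1 → ∀ s : ZMod 8, s = 1 ∨ s = -1 →
      (19 * c * (a + 2 * s * c + d) + (b + s * d) * d * (11 - 38 * c ^ 2) + 30 * (d - 1) -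
        57 * c * d + 12 * (if d = 3 ∨ d = 5 then 1 else 0) =
      19 * c * (a + d) + b * d * (11 - 38 * c ^ 2) + 30 * (d - 1) - 57 * c * d +
        12 * (if d = 3 ∨ d = 5 then 1 else 0) + 11 * s) ∧
      (19 * (c - s * a) * (a + (d - 2 * s * b)) +
        b * (d - 2 * s * b) * (11 - 38 * (c - s * a) ^ 2) + 30 * (d - 2 * s * b - 1) -
        57 * (c - s * a) * (d - 2 * s * b) +
        12 * (if d - 2 * s * b = 3 ∨ d - 2 * s * b = 5 then 1 else 0) =
      19 * c * (a + d) + b * d * (11 - 38 * c ^ 2) + 30 * (d - 1) - 57 * c * d +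
        12 * (if d = 3 ∨ d = 5 then 1 else 0) + 19 * s) := by
    decide +kernel
  have key3 : ∀ a b c d : ZMod 3, a * d - 2 * b * c = 1 → ∀ s : ZMod 3, s = 1 ∨ s = -1 →
      (19 * c * (a + 2 * s * c + d) + (b + s * d) * d * (11 - 38 * c ^ 2) + 30 * (d - 1) -
        57 * c * d =
      19 * c * (a + d) + b * d * (11 - 38 * c ^ 2) + 30 * (d - 1) - 57 * c * d + 11 * s) ∧
      (19 * (c - s * a) * (a + (d - 2 * s * b)) +
        b * (d - 2 * s * b) * (11 - 38 * (c - s * a) ^ 2) + 30 * (d - 2 * s * b - 1) -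
        57 * (c - s * a) * (d - 2 * s * b) =
      19 * c * (a + d) + b * d * (11 - 38 * c ^ 2) + 30 * (d - 1) - 57 * c * d + 19 * s) := by
    decide +kernel
  have h12 : (12 : ZMod 3) = 0 := by decide
  have hs8 (s : ℤ) (hs : s = 1 ∨ s = -1) : (s : ZMod 8) = 1 ∨ (s : ZMod 8) = -1 := by
    rcases hs with rfl | rfl <;> simp
  have hs3 (s : ℤ) (hs : s = 1 ∨ s = -1) : (s : ZMod 3) = 1 ∨ (s : ZMod 3) = -1 := by
    rcases hs with rfl | rfl <;> simp
  refine ⟨fun s hs ↦ Int.modEq_twenty_four_of_zmod ?_ ?_,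
    fun s hs ↦ Int.modEq_twenty_four_of_zmod ?_ ?_⟩
  · have := (key8 _ _ _ _ h8 s (hs8 s hs)).1
    simpa [multiplierExponent] using this
  · have := (key3 _ _ _ _ h3 s (hs3 s hs)).1
    simpa [multiplierExponent, h12] using this
  · have := (key8 _ _ _ _ h8 s (hs8 s hs)).2
    simpa [multiplierExponent] using this
  · have := (key3 _ _ _ _ h3 s (hs3 s hs)).2
    simpa [multiplierExponent, h12] using this

theorem expParam_two_mul_congr {m n : ℤ} (h : m ≡ n [ZMOD 24]) :
    expParam (2 * m) = expParam (2 * n) := by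
  have : 2 * m ≡ 2 * n [ZMOD 48] := h.mul_left' (c := 2)
  exact_mod_cast expParam_int_congr this

/-- The transformation law of `etaProd` under `Γ₀(2)`. -/
theorem etaProd_moebius (a b c d : ℤ) (hdet : a * d - 2 * b * c = 1) {z : ℂ} (hz : 0 < z.im) :
    etaProd ((a * z + b) / (2 * c * z + d)) =
      expParam (2 * multiplierExponent a b c d) * (2 * c * z + d) ^ 5 * etaProd z := by
  induction hN : a.natAbs + 2 * c.natAbs using Nat.strong_induction_on generalizing a b c d with
  | _ N ih =>
  have hne : (2 * c * z + d : ℂ) ≠ 0 := by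
    have := intCast_mul_add_ne_zero (c := 2 * c) (d := d)
      (by by_contra! h0; obtain ⟨h1, rfl⟩ := h0; have : c = 0 := by omega
          simp [this] at hdet) hz
    exact_mod_cast this
  have ha : a % 2 = 1 := by
    have : Odd (a * d) := ⟨b * c, by linarith⟩
    exact Int.odd_iff.mp (Int.odd_mul.mp this).1
  have lower (s : ℤ) (hs : s = 1 ∨ s = -1)
      (hlt : a.natAbs + 2 * (c - s * a).natAbs < N) :
      etaProd ((a * z + b) / (2 * c * z + d)) =
      expParam (2 * multiplierExponent a b c d) * (2 * c * z + d) ^ 5 * etaProd z := by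
    have hdet' : a * (d - 2 * s * b) - 2 * b * (c - s * a) = 1 := by linarith
    have h1 := ih _ hlt a b (c - s * a) (d - 2 * s * b) hdet' rfl
    have hpos := im_moebius_pos (a := a) (b := b) (c := 2 * (c - s * a)) (d := d - 2 * s * b)
      (by linarith) hz
    have he := expParam_two_mul_congr ((multiplierExponent_add hdet).2 s hs)
    have hne' : (2 * (c - s * a : ℤ) * z + (d - 2 * s * b : ℤ) : ℂ) ≠ 0 := by
      intro h0
      push_cast at h0 hpos
      simp [h0] at hpos
    have h2 := etaProd_div_one_sub (-s) hpos
    push_cast at h1 h2 hne' hpos he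
    have e1 : 1 - 2 * -s * ((a * z + b) / (2 * (c - s * a) * z + (d - 2 * s * b))) =
        (2 * c * z + d) / (2 * (c - s * a) * z + (d - 2 * s * b) : ℂ) := by
      rw [eq_div_iff hne', sub_mul, mul_assoc (2 * -s : ℂ), div_mul_cancel₀ _ hne']
      ring
    rw [e1, div_div_div_cancel_right₀ hne', h1, he, div_pow] at h2
    rw [h2]
    have e2 : expParam (2 * multiplierExponent a b c d) =
        expParam (38 * -s) * expParam (2 * (multiplierExponent a b c d + 19 * s)) := by
      rw [← expParam_add]
      congr 1
      ring
    rw [e2]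
    generalize (2 * (c - s * a) * z + (d - 2 * s * b) : ℂ) = D at hne'
    field_simp
  have upper (s : ℤ) (hs : s = 1 ∨ s = -1)
      (hlt : (a - 2 * s * c).natAbs + 2 * c.natAbs < N) :
      etaProd ((a * z + b) / (2 * c * z + d)) =
      expParam (2 * multiplierExponent a b c d) * (2 * c * z + d) ^ 5 * etaProd z := by
    have hdet' : (a - 2 * s * c) * d - 2 * (b - s * d) * c = 1 := by linarith
    have h1 := ih _ hlt (a - 2 * s * c) (b - s * d) c d hdet' rfl
    have he := expParam_two_mul_congr ((multiplierExponent_add hdet).1 (-s) (by omega))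
    have e1 : (a * z + b) / (2 * c * z + d) =
      ((a - 2 * s * c : ℤ) * z + (b - s * d : ℤ)) / (2 * c * z + d) + s := by
      rw [div_add' _ _ _ hne]
      congr 1
      push_cast
      ring
    rw [e1, etaProd_add_int, h1]
    have e2 : a - 2 * s * c = a + 2 * (-s) * c := by ring
    have e3 : b - s * d = b + (-s) * d := by ring
    rw [e2, e3, he, ← mul_assoc, ← mul_assoc, ← expParam_add]
    congr 4
    push_cast
    ring
  rcases eq_or_ne c 0 with rfl | hc
  · simp only [Int.cast_zero, mul_zero, zero_mul, zero_add, sub_zero] at hdet ⊢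
    rcases Int.mul_eq_one_iff_eq_one_or_neg_one.mp hdet with ⟨rfl, rfl⟩ | ⟨rfl, rfl⟩
    · have := etaProd_add_int z b
      have h1 : ¬ ((1 : ZMod 8) = 3 ∨ (1 : ZMod 8) = 5) := by decide
      simp only [multiplierExponent, Int.cast_one, if_neg h1]
      push_cast
      rw [one_mul, div_one, this]
      ring_nf
    · have := etaProd_add_int z (-b)
      have h1 : ¬ ((-1 : ZMod 8) = 3 ∨ (-1 : ZMod 8) = 5) := by decide
      have e1 : ((-1 : ℤ) * z + b) / (-1 : ℤ) = z + (-b : ℤ) := by push_cast; ring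
      have e2 : expParam (2 * multiplierExponent (-1) b 0 (-1)) =
          expParam (22 * (-b : ℤ)) * expParam (-120) := by
        simp only [multiplierExponent, Int.cast_neg, Int.cast_one, if_neg h1]
        rw [← expParam_add]
        congr 1
        push_cast
        ring
      have e3 : expParam (-120) = -1 := by
        have : expParam (-120) = expParam 24 := by
          exact_mod_cast expParam_int_congr (show -120 ≡ 24 [ZMOD 48] by decide)
        rw [this, expParam, ← Complex.exp_pi_mul_I]
        congr 1
        ring
      rw [e1, this, e2, e3]
      push_cast
      ring
  rcases lt_or_gt_of_ne (show a.natAbs ≠ 2 * c.natAbs by omega) with hlt | hlt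
  · by_cases hsgn : 0 < a ↔ 0 < c
    · exact lower 1 (by simp) (by omega)
    · exact lower (-1) (by simp) (by omega)
  · by_cases hsgn : 0 < a ↔ 0 < c
    · exact upper 1 (by simp) (by omega)
    · exact upper (-1) (by simp) (by omega)

theorem etaProd_moebius_of_modEq_one {a b c d : ℤ} (hdet : a * d - b * c = 1)
    (hb : 24 ∣ b) (hc : 48 ∣ c) (hd : 24 ∣ d - 1) {z : ℂ} (hz : 0 < z.im) :
    etaProd ((a * z + b) / (c * z + d)) = (c * z + d) ^ 5 * etaProd z := by
  obtain ⟨c, rfl⟩ := hc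
  have h := etaProd_moebius a b (24 * c) d (by linarith) hz
  have he : multiplierExponent a b (24 * c) d ≡ 0 [ZMOD 24] := by
    have h1 : ¬ ((d : ZMod 8) = 3 ∨ (d : ZMod 8) = 5) := by
      have : ((d : ℤ) : ZMod 8) = (1 : ℤ) :=
        (ZMod.intCast_eq_intCast_iff d 1 8).mpr (by simp only [Int.ModEq]; omega)
      rw [this]
      decide
    rw [Int.modEq_zero_iff_dvd, multiplierExponent, if_neg h1]
    obtain ⟨b, rfl⟩ := hb
    obtain ⟨e, hd⟩ := hd
    exact ⟨19 * c * (a + d) + b * d * (11 - 38 * (24 * c) ^ 2) + 30 * e - 57 * c * d,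
      by rw [hd]; ring⟩
  have he' := expParam_two_mul_congr he
  have : expParam (2 * (0 : ℤ)) = 1 := by simp [expParam]
  rw [this] at he'
  rw [he'] at h
  push_cast at h ⊢
  convert h using 3 <;> ring

/-- The Hecke operator of prime level `p` and weight `5`, for functions of period `48`. -/
noncomputable def heckeSum (p : ℕ) (f : ℂ → ℂ) (z : ℂ) : ℂ :=
  (p : ℂ)⁻¹ * ∑ b ∈ Finset.range p, f ((z + 48 * b) / p) + p ^ 4 * f (p * z)

theorem sum_range_eq_sum_zmod {M : Type*} [AddCommMonoid M] (p : ℕ) [NeZero p] (f : ℕ → M) :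
    ∑ b ∈ Finset.range p, f b = ∑ b : ZMod p, f b.val := by
  refine Finset.sum_nbij' (fun b ↦ (b : ZMod p)) ZMod.val (by simp)
    (fun b _ ↦ by simpa using ZMod.val_lt b) (fun b hb ↦ ZMod.val_cast_of_lt (by simpa using hb))
    (by simp) (fun b hb ↦ by rw [ZMod.val_cast_of_lt (by simpa using hb)])

theorem coprime_forty_eight {p : ℕ} (hp1 : p % 24 = 1) : Nat.Coprime 48 p := by
  have h1 : Nat.Coprime 24 p := by
    rw [Nat.Coprime, Nat.gcd_rec, hp1, Nat.gcd_one_left]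
  exact Nat.Coprime.mul_left (m := 24) (n := 2) h1 (h1.coprime_dvd_left (by norm_num))

theorem etaProd_neg_one_div_add_div {κ : ℂ}
    (hκ : ∀ z : ℂ, 0 < z.im → etaProd (-1 / z) = κ * z ^ 5 * etaProdDual z) {p b c : ℕ}
    (hp0 : 0 < p) (hp1 : p % 24 = 1) (hbc : p ∣ 1 + 48 ^ 2 * b * c) {z : ℂ} (hz : 0 < z.im) :
    etaProd ((-1 / z + 48 * b) / p) = κ * z ^ 5 * etaProdDual ((z + 48 * c) / p) := by
  obtain ⟨m, hm⟩ := hbc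
  have hm' : (1 + 48 ^ 2 * b * c : ℤ) = p * m := by exact_mod_cast hm
  have hmC : (1 + 48 ^ 2 * b * c : ℂ) = p * m := by exact_mod_cast hm
  have hpC : (p : ℂ) ≠ 0 := by exact_mod_cast hp0.ne'
  have hz0 : z ≠ 0 := by rintro rfl; simp at hz
  have hw := im_moebius_pos (a := 1) (b := 48 * c) (c := 0) (d := p) (by simpa using hp0) hz
  push_cast at hw
  simp only [one_mul, zero_mul, zero_add] at hw
  generalize hwdef : (z + 48 * c : ℂ) / p = w at hw
  have hzw : z = p * w - 48 * c := by rw [← hwdef]; field_simp; ring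
  have hw0 : w ≠ 0 := by rintro rfl; simp at hw
  have hu : 0 < (-1 / w).im := by
    simpa using im_moebius_pos (a := 0) (b := -1) (c := 1) (d := 0) (by norm_num) hw
  have h1 := etaProd_moebius_of_modEq_one (a := m) (b := 48 * b) (c := 48 * c) (d := p)
    (by linarith) (Dvd.dvd.mul_right (by norm_num) _) (dvd_mul_right _ _) (by omega) hu
  push_cast at h1
  have e1 : (48 * c * (-1 / w) + p : ℂ) = z / w := by rw [hzw]; field_simp; ring
  have e2 : (m * (-1 / w) + 48 * b : ℂ) / (z / w) = (-1 / z + 48 * b) / p := by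
    field_simp
    rw [hzw]
    linear_combination hmC
  rw [e1, e2, hκ w hw] at h1
  rw [h1]
  field_simp

theorem heckeSum_etaProd_neg_one_div {κ : ℂ}
    (hκ : ∀ z : ℂ, 0 < z.im → etaProd (-1 / z) = κ * z ^ 5 * etaProdDual z) {p : ℕ}
    (hp : p.Prime) (hp1 : p % 24 = 1) {z : ℂ} (hz : 0 < z.im) :
    heckeSum p etaProd (-1 / z) = κ * z ^ 5 * heckeSum p etaProdDual z := by
  have : Fact p.Prime := ⟨hp⟩
  have hpC : (p : ℂ) ≠ 0 := by exact_mod_cast hp.ne_zero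
  have hz0 : z ≠ 0 := by rintro rfl; simp at hz
  have h48 : (48 : ZMod p) ≠ 0 := by
    have := (ZMod.isUnit_iff_coprime 48 p).mpr (coprime_forty_eight hp1)
    exact_mod_cast this.ne_zero
  have hinv : Function.Involutive fun b : ZMod p ↦ -(48 ^ 2 * b)⁻¹ := by
    intro b
    by_cases hb : b = 0
    · simp [hb]
    · field_simp
  have hpR : (0 : ℝ) < p := by exact_mod_cast hp.pos
  have hzp : 0 < (z / p).im := by
    rw [Complex.div_natCast_im]; positivity
  have hpz : 0 < (p * z).im := by
    simpa using mul_pos hpR hz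
  rw [heckeSum, heckeSum, sum_range_eq_sum_zmod, sum_range_eq_sum_zmod,
    ← Equiv.sum_comp (Function.Involutive.toPerm _ hinv)
      (fun b ↦ etaProdDual ((z + 48 * (b.val : ℂ)) / p)),
    Fintype.sum_eq_add_sum_compl 0, Fintype.sum_eq_add_sum_compl (0 : ZMod p)]
  have h0 : etaProd ((-1 / z + 48 * ((0 : ZMod p).val : ℂ)) / p) =
      κ * (p * z) ^ 5 * etaProdDual (p * z) := by
    rw [← hκ _ hpz]
    congr 1
    simp
    field_simp
  have h1 : etaProd (p * (-1 / z)) = κ * (z / p) ^ 5 * etaProdDual (z / p) := by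
    rw [← hκ _ hzp]
    congr 1
    field_simp
  have h2 : ∑ b ∈ ({0}ᶜ : Finset (ZMod p)), etaProd ((-1 / z + 48 * (b.val : ℂ)) / p) =
      κ * z ^ 5 * ∑ b ∈ ({0}ᶜ : Finset (ZMod p)),
        etaProdDual ((z + 48 * ((Function.Involutive.toPerm _ hinv b).val : ℂ)) / p) := by
    rw [Finset.mul_sum]
    refine Finset.sum_congr rfl fun b hb ↦ ?_
    have hb0 : b ≠ 0 := by simpa using hb
    refine etaProd_neg_one_div_add_div hκ hp.pos hp1 ?_ hz
    rw [← ZMod.natCast_eq_zero_iff]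
    push_cast
    simp only [ZMod.natCast_val, ZMod.cast_id', id_eq, Function.Involutive.coe_toPerm]
    field_simp
    ring
  have h3 : Function.Involutive.toPerm _ hinv (0 : ZMod p) = 0 := by simp
  rw [h0, h1, h2, h3]
  simp only [ZMod.val_zero, Nat.cast_zero, mul_zero, add_zero]
  field_simp
  ring

theorem sum_expParam_pow {p : ℕ} (hp : 0 < p) (m : ℕ) :
    ∑ b ∈ Finset.range p, expParam (48 * b / p) ^ m = if p ∣ m then (p : ℂ) else 0 := by
  have hpC : (p : ℂ) ≠ 0 := by exact_mod_cast hp.ne'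
  have h (b : ℕ) : expParam (48 * b / p) ^ m = expParam (48 * m / p) ^ b := by
    rw [← expParam_nat_mul, ← expParam_nat_mul]
    congr 1
    ring
  simp only [h]
  split_ifs with hm
  · obtain ⟨k, rfl⟩ := hm
    have : expParam (48 * (p * k : ℕ) / p) = 1 := by
      rw [← expParam_forty_eight_mul_int k]
      congr 1
      push_cast
      field_simp
    simp only [this, one_pow, Finset.sum_const, Finset.card_range, nsmul_eq_mul, mul_one]
  · have h1 : expParam (48 * m / p) ≠ 1 := by
      rw [expParam, Ne, Complex.exp_eq_one_iff]
      rintro ⟨n, hn⟩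
      have : (m : ℂ) = n * p := by
        have hpi := Complex.two_pi_I_ne_zero
        field_simp at hn
        linear_combination hn
      have : (m : ℤ) = n * p := by exact_mod_cast this
      exact hm (by exact_mod_cast (Dvd.intro_left n this.symm))
    have h2 : expParam (48 * m / p) ^ p = 1 := by
      rw [← expParam_nat_mul, ← expParam_forty_eight_mul_int m]
      congr 1
      push_cast
      field_simp
    rw [geom_sum_eq h1, h2, sub_self, zero_div]

/-- The action of the Hecke operator on Fourier coefficients. -/
noncomputable def heckeCoeff {R : Type*} [CommRing R] (p : ℕ) (c : ℕ → R) (m : ℕ) : R :=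
  c (p * m) + if p ∣ m then (p : R) ^ 4 * c (m / p) else 0

theorem hasSum_heckeSum {p : ℕ} (hp : 0 < p) {f : ℂ → ℂ} {c : ℕ → ℂ}
    (hf : ∀ z : ℂ, 0 < z.im → HasSum (fun m ↦ c m * expParam z ^ m) (f z)) {z : ℂ}
    (hz : 0 < z.im) :
    HasSum (fun m ↦ heckeCoeff p c m * expParam z ^ m) (heckeSum p f z) := by
  have hpC : (p : ℂ) ≠ 0 := by exact_mod_cast hp.ne'
  have hpR : (0 : ℝ) < p := by exact_mod_cast hp
  have hinj : Function.Injective (p * · : ℕ → ℕ) := mul_right_injective₀ hp.ne'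
  have h1 : HasSum (fun m ↦ c (p * m) * expParam z ^ m)
      ((p : ℂ)⁻¹ * ∑ b ∈ Finset.range p, f ((z + 48 * b) / p)) := by
    have hb (b : ℕ) : 0 < ((z + 48 * b) / p).im := by
      rw [Complex.div_natCast_im]
      simpa using div_pos hz hpR
    have h := (hasSum_sum fun b (_ : b ∈ Finset.range p) ↦ hf _ (hb b)).mul_left (p : ℂ)⁻¹
    have e (m : ℕ) : (p : ℂ)⁻¹ * ∑ b ∈ Finset.range p, c m * expParam ((z + 48 * b) / p) ^ m =
        if p ∣ m then c m * expParam (z / p) ^ m else 0 := by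
      simp only [add_div, expParam_add, mul_pow, ← Finset.mul_sum, sum_expParam_pow hp]
      split_ifs
      · field_simp
      · simp
    simp only [e] at h
    rw [← hinj.hasSum_iff (fun m hm ↦ if_neg fun ⟨k, hk⟩ ↦ hm ⟨k, hk.symm⟩)] at h
    refine (congrArg (HasSum · _) (funext fun m ↦ ?_)).mpr h
    simp only [Function.comp_def, dvd_mul_right, if_true]
    rw [pow_mul, ← expParam_nat_mul p, mul_div_cancel₀ _ hpC]
  have h2 : HasSum (fun m ↦ (if p ∣ m then (p : ℂ) ^ 4 * c (m / p) else 0) * expParam z ^ m)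
      (p ^ 4 * f (p * z)) := by
    rw [← hinj.hasSum_iff]
    · have h := (hf (p * z) (by simpa using mul_pos hpR hz)).mul_left ((p : ℂ) ^ 4)
      refine (congrArg (HasSum · _) (funext fun m ↦ ?_)).mpr h
      simp only [Function.comp_def, dvd_mul_right, if_true, pow_mul, Nat.mul_div_cancel_left m hp]
      rw [← expParam_nat_mul, mul_assoc]
    · intro m hm
      rw [if_neg fun ⟨k, hk⟩ ↦ hm ⟨k, hk.symm⟩, zero_mul]
  refine (congrArg (HasSum · _) (funext fun m ↦ ?_)).mpr (h1.add h2)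
  rw [heckeCoeff, add_mul]

/-- The coefficients of `X ^ r * f (X ^ k)`. -/
noncomputable def spread {R : Type*} [Zero R] (k r : ℕ) (c : ℕ → R) (m : ℕ) : R :=
  if m % k = r then c (m / k) else 0

theorem hasSum_spread_iff {k r : ℕ} (hr : r < k) (d : ℕ → ℂ) (hd : ∀ m, m % k ≠ r → d m = 0)
    {x : ℂ} (hx : x ≠ 0) {S : ℂ} :
    HasSum (fun n ↦ d (k * n + r) * (x ^ k) ^ n) S ↔
      HasSum (fun m ↦ d m * x ^ m) (x ^ r * S) := by
  have hinj : Function.Injective (fun n ↦ k * n + r) := by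
    intro a b hab
    have : k * a = k * b := by simpa using hab
    exact Nat.eq_of_mul_eq_mul_left (by omega) this
  rw [← hasSum_mul_left_iff (pow_ne_zero r hx),
    ← hinj.hasSum_iff (f := fun m ↦ d m * x ^ m)]
  · refine Eq.to_iff (congrArg (HasSum · _) (funext fun n ↦ ?_))
    simp only [Function.comp_def]
    ring
  · intro m hm
    rw [hd, zero_mul]
    intro h
    exact hm ⟨m / k, by simpa [h] using Nat.div_add_mod m k⟩

theorem spread_apply {R : Type*} [Zero R] {k r : ℕ} (hr : r < k) (c : ℕ → R) (n : ℕ) :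
    spread k r c (k * n + r) = c n := by
  rw [spread, Nat.mul_add_mod, Nat.mod_eq_of_lt hr, if_pos rfl,
    Nat.mul_add_div (by omega), Nat.div_eq_of_lt hr, add_zero]

theorem spread_of_ne {R : Type*} [Zero R] {k r m : ℕ} (h : m % k ≠ r) (c : ℕ → R) :
    spread k r c m = 0 := if_neg h

theorem heckeCoeff_spread_of_ne {R : Type*} [CommRing R] {p k r : ℕ} (c : ℕ → R) (hp0 : 0 < p)
    (hp : p ^ 2 ≡ 1 [MOD k]) (hr : p * r ≡ r [MOD k]) (hrk : r < k) {m : ℕ} (hm : m % k ≠ r) :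
    heckeCoeff p (spread k r c) m = 0 := by
  have hmod (j : ℕ) : j % k = r ↔ j ≡ r [MOD k] := by
    rw [Nat.ModEq, Nat.mod_eq_of_lt hrk]
  have h1 : (p * m) % k ≠ r := by
    intro h
    have h2 : p * (p * m) ≡ p * r [MOD k] := Nat.ModEq.mul_left p ((hmod _).mp h)
    have h3 : p * (p * m) ≡ m [MOD k] := by
      simpa [pow_two, mul_assoc] using hp.mul_right m
    exact hm ((hmod m).mpr (h3.symm.trans (h2.trans hr)))
  rw [heckeCoeff, spread_of_ne h1, zero_add, ite_eq_right_iff]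
  rintro ⟨j, rfl⟩
  rw [Nat.mul_div_cancel_left j hp0, spread_of_ne, mul_zero]
  intro h
  exact hm ((hmod _).mpr ((Nat.ModEq.mul_left p ((hmod _).mp h)).trans hr))

open Filter Topology UpperHalfPlane ModularForm MatrixGroups CongruenceSubgroup in
theorem levelOne_eq_zero {H : ℂ → ℂ} (hd : DifferentiableOn ℂ H {z | 0 < z.im})
    (hT : ∀ z : ℂ, 0 < z.im → H (z + 1) = H z) (hS : ∀ z : ℂ, 0 < z.im → H (-1 / z) = H z)
    (h0 : Tendsto H (comap Complex.im atTop) (𝓝 0)) {z : ℂ} (hz : 0 < z.im) : H z = 0 := by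
  let f : ℍ → ℂ := fun z ↦ H z
  have hfS : f ∣[(0 : ℤ)] ModularGroup.S = f := by
    ext z
    rw [SL_slash_apply, UpperHalfPlane.modular_S_smul]
    have h := hS z z.2
    rw [neg_div, one_div] at h
    simpa [f, inv_neg] using h
  have hfT : f ∣[(0 : ℤ)] ModularGroup.T = f := by
    ext z
    rw [SL_slash_apply, modular_T_smul]
    have h := hT z z.2
    simpa [f, add_comm] using h
  have hzero : IsZeroAtImInfty f := h0.comp tendsto_coe_atImInfty
  let g : ModularForm 𝒮ℒ 0 :=
    { toFun := f
      slash_action_eq' := by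
        rintro A ⟨A, rfl⟩
        exact SlashInvariantForm.slash_action_generators_SL2Z hfS hfT A
      holo' := by
        rw [UpperHalfPlane.mdifferentiable_iff]
        refine hd.congr fun z hz ↦ ?_
        simp [f, ofComplex_apply_of_im_pos hz]
      bdd_at_cusps' := by
        intro c hc
        rw [Subgroup.IsArithmetic.isCusp_iff_isCusp_SL2Z] at hc
        rw [OnePoint.isBoundedAt_iff_forall_SL2Z hc]
        intro γ _
        rw [SlashInvariantForm.slash_action_generators_SL2Z hfS hfT]
        exact hzero.isBoundedAtImInfty }
  obtain ⟨c, hc⟩ := ModularFormClass.levelOne_weight_zero_const g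
  have hc' : f = Function.const _ c := hc
  have : c = 0 := by
    rw [hc'] at hzero
    exact tendsto_nhds_unique tendsto_const_nhds hzero
  have h1 := congrFun hc' ⟨z, hz⟩
  simpa [f, this] using h1

open Filter Topology in
theorem eqOn_zero_of_conjugates {h h₀ : ℂ → ℂ} (hd : DifferentiableOn ℂ h {z | 0 < z.im})
    (hd₀ : DifferentiableOn ℂ h₀ {z | 0 < z.im})
    (hT : ∀ z : ℂ, 0 < z.im → h (z + 1) = h z) (hS : ∀ z : ℂ, 0 < z.im → h (-1 / z) = h₀ z)
    (hT₀ : ∀ z : ℂ, 0 < z.im → h₀ (z + 2) = h₀ z)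
    (hlim : Tendsto h (comap Complex.im atTop) (𝓝 0)) {l : ℂ}
    (hlim₀ : Tendsto h₀ (comap Complex.im atTop) (𝓝 l)) : Set.EqOn h 0 {z | 0 < z.im} := by
  have hinv {z : ℂ} (hz : 0 < z.im) : 0 < (-1 / z).im := by
    simpa using im_moebius_pos (a := 0) (b := -1) (c := 1) (d := 0) (by norm_num) hz
  have hadd {z : ℂ} (hz : 0 < z.im) : 0 < (z + 1).im := by simpa using hz
  have hsub {z : ℂ} (hz : 0 < z.im) : 0 < (z - 1).im := by simpa using hz
  have hne {z : ℂ} (hz : 0 < z.im) : z ≠ 0 := by rintro rfl; simp at hz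
  have hS' {z : ℂ} (hz : 0 < z.im) : h₀ (-1 / z) = h z := by
    rw [← hS _ (hinv hz)]
    congr 1
    have := hne hz
    field_simp
  have hd₁ : DifferentiableOn ℂ (fun z ↦ h₀ (z + 1)) {z | 0 < z.im} :=
    hd₀.comp (by fun_prop) fun z hz ↦ hadd hz
  have hlim₁ : Tendsto (fun z ↦ h₀ (z + 1)) (comap Complex.im atTop) (𝓝 l) := by
    refine hlim₀.comp ?_
    rw [tendsto_comap_iff]
    simpa [Function.comp_def] using tendsto_comap
  have key : ∀ z ∈ {z : ℂ | 0 < z.im}, (h * (h₀ * fun z ↦ h₀ (z + 1))) z = 0 := by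
    intro z hz
    refine levelOne_eq_zero (hd.mul (hd₀.mul hd₁)) ?_ ?_ ?_ hz
    · intro z hz
      simp only [Pi.mul_apply]
      rw [hT z hz, add_assoc, one_add_one_eq_two, hT₀ z hz]
      ring
    · intro z hz
      have e : h₀ (-1 / z + 1) = h₀ (z + 1) := by
        have h1 := hne hz
        have h2 := hne (hsub hz)
        calc h₀ (-1 / z + 1) = h₀ (-1 / (-z / (z - 1))) := by
              congr 1
              field_simp
              ring
          _ = h (-z / (z - 1)) := hS' (by
              have := im_moebius_pos (a := -1) (b := 0) (c := 1) (d := -1) (by norm_num) hz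
              simpa [sub_eq_add_neg] using this)
          _ = h (-z / (z - 1) + 1) := (hT _ (by
              have := im_moebius_pos (a := -1) (b := 0) (c := 1) (d := -1) (by norm_num) hz
              simpa [sub_eq_add_neg] using this)).symm
          _ = h (-1 / (z - 1)) := by
              congr 1
              field_simp
              ring
          _ = h₀ (z - 1) := hS _ (hsub hz)
          _ = h₀ (z - 1 + 2) := (hT₀ _ (hsub hz)).symm
          _ = h₀ (z + 1) := by congr 1; ring
      simp only [Pi.mul_apply]
      rw [hS z hz, hS' hz, e]
      ring
    · have := hlim.mul (hlim₀.mul hlim₁)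
      rwa [zero_mul] at this
  have hopen := UpperHalfPlane.isOpen_upperHalfPlaneSet
  have hconn : IsPreconnected {z : ℂ | 0 < z.im} := (convex_halfSpace_im_gt 0).isPreconnected
  have ha := hd.analyticOnNhd hopen
  have ha₀ := hd₀.analyticOnNhd hopen
  have ha₁ := hd₁.analyticOnNhd hopen
  rcases ha.eq_zero_or_eq_zero_of_mul_eq_zero (ha₀.mul ha₁) key hconn with h1 | h1
  · exact h1
  rcases ha₀.eq_zero_or_eq_zero_of_mul_eq_zero ha₁ h1 hconn with h2 | h2
  · intro z hz
    rw [← hS' hz]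
    exact h2 _ (hinv hz)
  · intro z hz
    rw [← hS' hz]
    have := h2 _ (hsub (hinv hz))
    simpa using this

open Filter Topology in
theorem hasFPowerSeriesAt_of_hasSum {d : ℕ → ℂ} {S : ℂ → ℂ}
    (h : ∀ q : ℂ, ‖q‖ < 1 → HasSum (fun n ↦ d n * q ^ n) (S q)) :
    HasFPowerSeriesAt S (FormalMultilinearSeries.ofScalars ℂ d) 0 := by
  rw [hasFPowerSeriesAt_iff]
  filter_upwards [Metric.ball_mem_nhds (0 : ℂ) one_pos] with q hq
  rw [zero_add]
  simpa [mul_comm] using h q (by simpa using hq)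

theorem exists_expParam_pow_eq {q : ℂ} (hq0 : q ≠ 0) (hq : ‖q‖ < 1) {k : ℕ} (hk : 0 < k) :
    ∃ z : ℂ, 0 < z.im ∧ expParam z ^ k = q := by
  have hkC : (k : ℂ) ≠ 0 := by exact_mod_cast hk.ne'
  refine ⟨(48 / k : ℝ) * Function.Periodic.invQParam 1 q, ?_, ?_⟩
  · rw [Complex.im_ofReal_mul]
    exact mul_pos (by positivity)
      (Function.Periodic.im_invQParam_pos_of_norm_lt_one one_pos hq hq0)
  · refine Eq.trans ?_ (Function.Periodic.qParam_right_inv one_ne_zero hq0)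
    rw [← expParam_nat_mul, expParam, Function.Periodic.qParam]
    congr 1
    push_cast
    field_simp

theorem exists_heckeSum_eq {p k r : ℕ} (hp0 : 0 < p) (hp : p ^ 2 ≡ 1 [MOD k])
    (hr : p * r ≡ r [MOD k]) (hrk : r < k) {f A : ℂ → ℂ} {c : ℕ → ℂ}
    (hA : ∀ q : ℂ, ‖q‖ < 1 → HasSum (fun n ↦ c n * q ^ n) (A q))
    (hf : ∀ z, f z = expParam z ^ r * A (expParam z ^ k)) :
    ∃ S : ℂ → ℂ, (∀ q : ℂ, ‖q‖ < 1 →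
      HasSum (fun n ↦ heckeCoeff p (spread k r c) (k * n + r) * q ^ n) (S q)) ∧
      ∀ z : ℂ, 0 < z.im → heckeSum p f z = expParam z ^ r * S (expParam z ^ k) := by
  have hk : 0 < k := by omega
  have hlt {z : ℂ} (hz : 0 < z.im) : ‖expParam z ^ k‖ < 1 := by
    rw [norm_pow]
    exact pow_lt_one₀ (norm_nonneg _) (norm_expParam_lt_one hz) hk.ne'
  have hsum (z : ℂ) (hz : 0 < z.im) :
      HasSum (fun m ↦ spread k r c m * expParam z ^ m) (f z) := by
    rw [hf, ← hasSum_spread_iff hrk _ (fun m hm ↦ spread_of_ne hm c) (expParam_ne_zero z)]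
    simpa only [spread_apply hrk] using hA _ (hlt hz)
  have hG (z : ℂ) (hz : 0 < z.im) := hasSum_heckeSum hp0 hsum hz
  have hG' (z : ℂ) (hz : 0 < z.im) :
      HasSum (fun n ↦ heckeCoeff p (spread k r c) (k * n + r) * (expParam z ^ k) ^ n)
        (heckeSum p f z / expParam z ^ r) := by
    rw [hasSum_spread_iff hrk _ (fun m hm ↦ heckeCoeff_spread_of_ne c hp0 hp hr hrk hm)
      (expParam_ne_zero z), mul_div_cancel₀ _ (pow_ne_zero _ (expParam_ne_zero z))]
    exact hG z hz
  refine ⟨fun q ↦ ∑' n, heckeCoeff p (spread k r c) (k * n + r) * q ^ n, fun q hq ↦ ?_,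
    fun z hz ↦ ?_⟩
  · apply Summable.hasSum
    rcases eq_or_ne q 0 with rfl | hq0
    · refine summable_of_ne_finset_zero (s := {0}) fun n hn ↦ ?_
      rw [zero_pow (by simpa using hn), mul_zero]
    · obtain ⟨z, hz, rfl⟩ := exists_expParam_pow_eq hq0 hq hk
      exact (hG' z hz).summable
  · simp only [(hG' z hz).tsum_eq]
    rw [mul_div_cancel₀ _ (pow_ne_zero _ (expParam_ne_zero z))]

open Filter Topology in
theorem tendsto_expParam_pow {k : ℕ} (hk : 0 < k) :
    Tendsto (fun z ↦ expParam z ^ k) (comap Complex.im atTop) (𝓝 0) := by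
  rw [tendsto_zero_iff_norm_tendsto_zero]
  have h (z : ℂ) : ‖expParam z ^ k‖ = Real.exp (-(k * (2 * Real.pi / 48) * z.im)) := by
    rw [← expParam_nat_mul, expParam, Complex.norm_exp]
    congr 1
    simp [Complex.mul_re, Complex.mul_im]
    ring
  simp only [h]
  refine Real.tendsto_exp_neg_atTop_nhds_zero.comp ?_
  have hk' : 0 < (k * (2 * Real.pi / 48) : ℝ) := by
    have := Real.pi_pos
    positivity
  exact tendsto_comap.const_mul_atTop hk'

open UpperHalfPlane ModularForm in
theorem differentiableOn_etaProd : DifferentiableOn ℂ etaProd {z | 0 < z.im} := by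
  intro z hz
  have hz' : 0 < (2 * z).im := by simpa using hz
  have h1 := differentiableAt_eta_of_mem_upperHalfPlaneSet hz
  have h2 : DifferentiableAt ℂ (fun w ↦ η (2 * w)) z :=
    (differentiableAt_eta_of_mem_upperHalfPlaneSet hz').comp z (by fun_prop)
  exact ((h1.pow 9).mul h2).differentiableWithinAt

open UpperHalfPlane ModularForm in
theorem differentiableOn_etaProdDual : DifferentiableOn ℂ etaProdDual {z | 0 < z.im} := by
  intro z hz
  have hz' : 0 < (z / 2).im := by simpa using! hz
  have h1 := differentiableAt_eta_of_mem_upperHalfPlaneSet hz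
  have h2 : DifferentiableAt ℂ (fun w ↦ η (w / 2)) z :=
    DifferentiableAt.comp z (f := fun w : ℂ ↦ w / 2) (g := η)
      (differentiableAt_eta_of_mem_upperHalfPlaneSet hz') (by fun_prop)
  exact ((h1.pow 9).mul h2).differentiableWithinAt

theorem DifferentiableOn.heckeSum {p : ℕ} (hp : 0 < p) {f : ℂ → ℂ}
    (hf : DifferentiableOn ℂ f {z | 0 < z.im}) :
    DifferentiableOn ℂ (heckeSum p f) {z | 0 < z.im} := by
  have hpR : (0 : ℝ) < p := by exact_mod_cast hp
  refine ((DifferentiableOn.fun_sum fun b _ ↦ ?_).const_mul _).add (DifferentiableOn.const_mul ?_ _)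
  · refine hf.comp (g := f) (f := fun z : ℂ ↦ (z + 48 * b) / p) (by fun_prop) fun z hz ↦ ?_
    have : 0 < z.im / p := div_pos hz hpR
    simpa [Complex.div_natCast_im] using this
  · refine hf.comp (g := f) (f := fun z : ℂ ↦ p * z) (by fun_prop) fun z hz ↦ ?_
    simpa using mul_pos hpR hz

open ModularForm in
theorem etaProd_ne_zero {z : ℂ} (hz : 0 < z.im) : etaProd z ≠ 0 :=
  mul_ne_zero (pow_ne_zero _ (eta_ne_zero hz)) (eta_ne_zero (by simpa using hz))

open ModularForm in
theorem etaProdDual_ne_zero {z : ℂ} (hz : 0 < z.im) : etaProdDual z ≠ 0 :=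
  mul_ne_zero (pow_ne_zero _ (eta_ne_zero hz)) (eta_ne_zero (by simpa using! hz))

theorem eulerFun_zero : eulerFun 0 = 1 := by simp [eulerFun]

theorem eq_of_hasSum_of_eq {c d : ℕ → ℂ} {S T : ℂ → ℂ}
    (hS : ∀ q : ℂ, ‖q‖ < 1 → HasSum (fun n ↦ c n * q ^ n) (S q))
    (hT : ∀ q : ℂ, ‖q‖ < 1 → HasSum (fun n ↦ d n * q ^ n) (T q))
    (h : ∀ q : ℂ, q ≠ 0 → ‖q‖ < 1 → S q = T q) : c = d := by
  have hS' := hasFPowerSeriesAt_of_hasSum hS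
  have hT' := hasFPowerSeriesAt_of_hasSum hT
  have h1 : S =ᶠ[nhdsWithin 0 {0}ᶜ] T := by
    filter_upwards [self_mem_nhdsWithin,
      nhdsWithin_le_nhds (Metric.ball_mem_nhds (0 : ℂ) one_pos)] with q hq0 hq
    exact h q hq0 (by simpa using hq)
  have h2 := (hS'.continuousAt.eventuallyEq_nhds_iff_eventuallyEq_nhdsNE hT'.continuousAt).mp h1
  have h3 := (hS'.congr h2).eq_formalMultilinearSeries hT'
  ext n
  have := congrArg (fun P ↦ FormalMultilinearSeries.coeff P n) h3
  simpa using this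

open Filter Topology in
theorem tendsto_heckeSum_div {k r : ℕ} (hk : 0 < k) {g f S A : ℂ → ℂ} {c d : ℕ → ℂ}
    (hS : ∀ q : ℂ, ‖q‖ < 1 → HasSum (fun n ↦ d n * q ^ n) (S q))
    (hA : ∀ q : ℂ, ‖q‖ < 1 → HasSum (fun n ↦ c n * q ^ n) (A q))
    (hA0 : A 0 = 1)
    (hg : ∀ z : ℂ, 0 < z.im → g z = expParam z ^ r * S (expParam z ^ k))
    (hf : ∀ z, f z = expParam z ^ r * A (expParam z ^ k)) :
    Tendsto (fun z ↦ g z / f z) (comap Complex.im atTop) (𝓝 (d 0)) := by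
  have h0 : S 0 = d 0 := by
    refine (hS 0 (by simp)).unique ?_
    convert hasSum_single 0 fun n hn ↦ ?_ using 1
    · simp
    · simp [hn]
  have h1 := (hasFPowerSeriesAt_of_hasSum hS).continuousAt.tendsto.comp (tendsto_expParam_pow hk)
  have h2 := (hasFPowerSeriesAt_of_hasSum hA).continuousAt.tendsto.comp (tendsto_expParam_pow hk)
  have h3 := h1.div h2 (by rw [hA0]; exact one_ne_zero)
  rw [h0, hA0, div_one] at h3
  refine h3.congr' ?_
  filter_upwards [preimage_mem_comap (Ioi_mem_atTop 0)] with z hz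
  rw [hf, hg z hz, mul_div_mul_left _ _ (pow_ne_zero _ (expParam_ne_zero z))]
  rfl

theorem sq_modEq_one_of_mod {p : ℕ} (hp1 : p % 24 = 1) : p ^ 2 ≡ 1 [MOD 48] := by
  have : p % 48 = 1 ∨ p % 48 = 25 := by omega
  rcases this with h | h <;> simp [Nat.ModEq, Nat.pow_mod, h]

/-- The coefficients of `etaProd` are those of an eigenform of the Hecke operators of prime level
`p ≡ 1` modulo `24`. -/
theorem heckeCoeff_spread_eulerProd {p : ℕ} (hp : p.Prime) (hp1 : p % 24 = 1) :
    heckeCoeff p (spread 48 22 fun n ↦ (eulerProd.coeff n : ℂ)) =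
      fun m ↦ (eulerProd.coeff (11 * (p - 1) / 24) : ℂ) *
        spread 48 22 (fun n ↦ (eulerProd.coeff n : ℂ)) m := by
  have hp2 := sq_modEq_one_of_mod hp1
  have hr : p * 22 ≡ 22 [MOD 48] := by simp only [Nat.ModEq]; omega
  have hr₀ : p * 19 ≡ 19 [MOD 24] := by simp only [Nat.ModEq]; omega
  obtain ⟨κ, hκ0, hκ⟩ := exists_etaProd_neg_one_div
  obtain ⟨S, hS, hG⟩ := exists_heckeSum_eq hp.pos hp2 hr (by norm_num) convergesTo_eulerProd
    etaProd_eq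
  obtain ⟨S₀, hS₀, hG₀⟩ := exists_heckeSum_eq hp.pos (hp2.of_dvd (by norm_num)) hr₀ (by norm_num)
    convergesTo_eulerProdDual etaProdDual_eq
  have hlam : heckeCoeff p (spread 48 22 fun n ↦ (eulerProd.coeff n : ℂ)) 22 =
      eulerProd.coeff (11 * (p - 1) / 24) := by
    have h1 : ¬ p ∣ 22 := by
      intro h
      have := Nat.le_of_dvd (by norm_num) h
      have := hp.one_lt
      omega
    have h2 : p * 22 = 48 * (11 * (p - 1) / 24) + 22 := by omega
    rw [heckeCoeff, if_neg h1, h2, spread_apply (by norm_num), add_zero]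
  generalize (eulerProd.coeff (11 * (p - 1) / 24) : ℂ) = lam at hlam ⊢
  have hzero := eqOn_zero_of_conjugates (h := fun z ↦ heckeSum p etaProd z / etaProd z - lam)
    (h₀ := fun z ↦ heckeSum p etaProdDual z / etaProdDual z - lam)
    (((differentiableOn_etaProd.heckeSum hp.pos).div differentiableOn_etaProd
      fun z hz ↦ etaProd_ne_zero hz).sub_const _)
    (((differentiableOn_etaProdDual.heckeSum hp.pos).div differentiableOn_etaProdDual
      fun z hz ↦ etaProdDual_ne_zero hz).sub_const _)
    (by
      intro z hz
      have e : expParam (z + 1) ^ 48 = expParam z ^ 48 := by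
        rw [expParam_add, mul_pow, expParam_one_pow, mul_one]
      simp only [etaProd_eq, hG z hz, hG (z + 1) (by simpa using hz), e,
        mul_div_mul_left _ _ (pow_ne_zero _ (expParam_ne_zero _))])
    (by
      intro z hz
      have hz0 : z ≠ 0 := by rintro rfl; simp at hz
      simp only [hκ z hz, heckeSum_etaProd_neg_one_div hκ hp hp1 hz]
      rw [mul_div_mul_left _ _ (mul_ne_zero hκ0 (pow_ne_zero _ hz0))])
    (by
      intro z hz
      have e : expParam (z + 2) ^ 24 = expParam z ^ 24 := by
        rw [← one_add_one_eq_two, expParam_add, expParam_add, mul_pow, mul_pow, ← pow_add,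
          expParam_one_pow, mul_one]
      simp only [etaProdDual_eq, hG₀ z hz, hG₀ (z + 2) (by simpa using hz), e,
        mul_div_mul_left _ _ (pow_ne_zero _ (expParam_ne_zero _))])
    (by
      have h := tendsto_heckeSum_div (by norm_num) hS convergesTo_eulerProd
        (by simp [eulerFun_zero]) hG etaProd_eq
      simpa [hlam] using h.sub_const lam)
    ((tendsto_heckeSum_div (by norm_num) hS₀ convergesTo_eulerProdDual
        (by simp [eulerFun_zero]) hG₀ etaProdDual_eq).sub_const lam)
  have hT : ∀ q : ℂ, ‖q‖ < 1 → HasSum (fun n ↦ lam * (eulerProd.coeff n : ℂ) * q ^ n)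
      (lam * (eulerFun q ^ 9 * eulerFun (q ^ 2))) := fun q hq ↦ by
    simpa only [mul_assoc] using (convergesTo_eulerProd q hq).mul_left lam
  have hcoeff := eq_of_hasSum_of_eq hS hT (by
      intro q hq0 hq
      obtain ⟨z, hz, rfl⟩ := exists_expParam_pow_eq hq0 hq (k := 48) (by norm_num)
      have h := hzero hz
      simp only [Pi.zero_apply] at h
      rw [sub_eq_zero, div_eq_iff (etaProd_ne_zero hz), hG z hz, etaProd_eq] at h
      exact mul_left_cancel₀ (pow_ne_zero 22 (expParam_ne_zero z)) (by rw [h]; ring))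
  ext m
  by_cases hm : m % 48 = 22
  · obtain ⟨n, rfl⟩ : ∃ n, m = 48 * n + 22 := ⟨m / 48, by omega⟩
    rw [spread_apply (by norm_num)]
    exact congrFun hcoeff n
  · rw [heckeCoeff_spread_of_ne _ hp.pos hp2 hr (by norm_num) hm, spread_of_ne hm, mul_zero]

theorem heckeCoeff_map {R S : Type*} [CommRing R] [CommRing S] (φ : R →+* S) (p : ℕ) (c : ℕ → R)
    (m : ℕ) : φ (heckeCoeff p c m) = heckeCoeff p (fun n ↦ φ (c n)) m := by
  rw [heckeCoeff, heckeCoeff]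
  split_ifs <;> simp

theorem spread_map {R S : Type*} [CommRing R] [CommRing S] (φ : R →+* S) (k r : ℕ) (c : ℕ → R) :
    (fun m ↦ φ (spread k r c m)) = spread k r (fun n ↦ φ (c n)) := by
  ext m
  rw [spread, spread]
  split_ifs <;> simp

theorem heckeCoeff_eulerProd {p : ℕ} (hp : p.Prime) (hp1 : p % 24 = 1) (m : ℕ) :
    heckeCoeff p (spread 48 22 fun n ↦ eulerProd.coeff n) m =
      eulerProd.coeff (11 * (p - 1) / 24) * spread 48 22 (fun n ↦ eulerProd.coeff n) m := by
  apply Int.cast_injective (α := ℂ)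
  have h1 := heckeCoeff_map (Int.castRingHom ℂ) p (spread 48 22 fun n ↦ eulerProd.coeff n) m
  have h2 := spread_map (Int.castRingHom ℂ) 48 22 fun n ↦ eulerProd.coeff n
  have h3 := congrFun (heckeCoeff_spread_eulerProd hp hp1) m
  simp only [eq_intCast] at h1 h2
  rw [h1, Int.cast_mul, h2, h3, ← h2]

theorem heckeCoeff_B {p : ℕ} (hp : p.Prime) (hp1 : p % 24 = 1)
    (hB : B 11 2 (11 * (p - 1) / 24) ≡ 0 [MOD 11]) (m : ℕ) :
    heckeCoeff p (spread 48 22 fun n ↦ (B 11 2 n : ZMod 11)) m = 0 := by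
  have hB' : ((eulerProd.coeff (11 * (p - 1) / 24) : ℤ) : ZMod 11) = 0 := by
    rw [← B_eleven_two_eq_coeff]
    exact (ZMod.natCast_eq_zero_iff _ _).mpr ((Nat.modEq_zero_iff_dvd).mp hB)
  have h1 := heckeCoeff_map (Int.castRingHom (ZMod 11)) p
    (spread 48 22 fun n ↦ eulerProd.coeff n) m
  have h2 := spread_map (Int.castRingHom (ZMod 11)) 48 22 fun n ↦ eulerProd.coeff n
  simp only [eq_intCast] at h1 h2
  simp only [B_eleven_two_eq_coeff]
  rw [← h2, ← h1, heckeCoeff_eulerProd hp hp1, Int.cast_mul, hB', zero_mul]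

/-- Vanishing at odd powers of `p` of the coefficients annihilated by the Hecke operator. -/
theorem eq_zero_of_heckeCoeff_eq_zero {R : Type*} [CommRing R] {p : ℕ} (hp : 0 < p) {c : ℕ → R}
    (h : ∀ m, heckeCoeff p c m = 0) {m : ℕ} (hm : ¬ p ∣ m) (α : ℕ) :
    c (p ^ (2 * α + 1) * m) = 0 := by
  induction α with
  | zero =>
    have := h m
    rw [heckeCoeff, if_neg hm, add_zero] at this
    simpa using this
  | succ α ih =>
    have := h (p * (p ^ (2 * α + 1) * m))
    rw [heckeCoeff, if_pos (dvd_mul_right _ _), Nat.mul_div_cancel_left _ hp, ih, mul_zero,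
      add_zero] at this
    rw [← this]
    congr 1
    ring

/-- Theorem 1.7(ii). -/
theorem B_11_2_newman_cong (p : ℕ) (hp : p.Prime) (hp1 : p % 24 = 1)
    (hB : B 11 2 (11 * (p - 1) / 24) ≡ 0 [MOD 11]) (α n : ℕ) (hn : ¬ p ∣ (24 * n + 11)) :
    B 11 2 (p ^ (2 * α + 1) * n + 11 * (p ^ (2 * α + 1) - 1) / 24) ≡ 0 [MOD 11] := by
  have hm : ¬ p ∣ 48 * n + 22 := by
    intro h
    have h2 : p ∣ 2 * (24 * n + 11) := by convert h using 1; ring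
    refine hn (((Nat.Coprime.symm ?_).dvd_of_dvd_mul_left) h2)
    exact (coprime_forty_eight hp1).coprime_dvd_left (by norm_num)
  have h := eq_zero_of_heckeCoeff_eq_zero hp.pos (heckeCoeff_B hp hp1 hB) hm α
  have hpow : p ^ (2 * α + 1) % 24 = 1 := by rw [Nat.pow_mod, hp1]; simp
  have e : p ^ (2 * α + 1) * (48 * n + 22) =
      48 * (p ^ (2 * α + 1) * n + 11 * (p ^ (2 * α + 1) - 1) / 24) + 22 := by
    have : p ^ (2 * α + 1) * (48 * n + 22) =
      48 * (p ^ (2 * α + 1) * n) + 22 * p ^ (2 * α + 1) := by ring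
    omega
  rw [e, spread_apply (by norm_num)] at h
  exact Nat.modEq_zero_iff_dvd.mpr ((ZMod.natCast_eq_zero_iff _ _).mp h)
end

section
/- Let p ≥ 5 be a prime number and suppose w_1(p) ≡ 0 (mod 2). Then for all nonnegative integers n and k with p ∤ n, we have B_{4,3}( p^{4k+3} n + 5(p^{4k+4} − 1)/24 ) ≡ 0 (mod 2). -/
/-- `a1 n` is the coefficient of `q^n` in `∏ (1 - q^k)^2 (1 - q^{3k})`. -/
noncomputable def a1 (n : ℕ) : ℤ :=
  (∏ k ∈ Finset.Icc 1 n,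
      ((1 - Polynomial.X ^ k) ^ 2 * (1 - Polynomial.X ^ (3 * k)) : Polynomial ℤ)).coeff n

/-- `w1 p = a1(5(p²−1)/24) + (−6/p)_L (−5(p²−1)/24 / p)_L` for a prime `p ≥ 5`. -/
noncomputable def w1 (p : ℕ) (hp : p.Prime) : ℤ :=
  a1 (5 * (p ^ 2 - 1) / 24)
    + @legendreSym p ⟨hp⟩ (-6) * @legendreSym p ⟨hp⟩ (-((5 * (p ^ 2 - 1) / 24 : ℕ) : ℤ))

/-- Integer points on the ellipse `2x² + 3y² = N` with both coordinates congruent to `1` modulo `6`. -/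
def ellipsePoints (N : ℤ) : Set (ℤ × ℤ) :=
  {z | z.1 % 6 = 1 ∧ z.2 % 6 = 1 ∧ 2 * z.1 ^ 2 + 3 * z.2 ^ 2 = N}

lemma finite_ellipsePoints (N : ℤ) : (ellipsePoints N).Finite := by
  refine ((Set.finite_Icc (-N) N).prod (Set.finite_Icc (-N) N)).subset ?_
  rintro ⟨x, y⟩ ⟨-, -, h⟩
  simp only at h
  have hx : |x| ≤ N := by nlinarith [Int.natAbs_le_self_sq x, Int.natCast_natAbs x, sq_nonneg y]
  have hy : |y| ≤ N := by nlinarith [Int.natAbs_le_self_sq y, Int.natCast_natAbs y, sq_nonneg x]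
  exact ⟨abs_le.mp hx, abs_le.mp hy⟩

/-- Multiplication by `a + b√-6` acting on `x√2 + y√-3`. -/
def twist (a b : ℤ) (z : ℤ × ℤ) : ℤ × ℤ := (a * z.1 - 3 * b * z.2, a * z.2 + 2 * b * z.1)

lemma twist_injective {p a b : ℤ} (hp : p ≠ 0) (hab : a ^ 2 + 6 * b ^ 2 = p ^ 2) :
    Function.Injective (twist a b) := by
  rintro ⟨x, y⟩ ⟨u, v⟩ h
  simp only [twist, Prod.mk.injEq] at h
  obtain ⟨h1, h2⟩ := h
  have hp2 : p ^ 2 ≠ 0 := pow_ne_zero 2 hp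
  refine Prod.ext (mul_left_cancel₀ hp2 ?_) (mul_left_cancel₀ hp2 ?_)
  · simp only [← hab]
    linear_combination a * h1 + 3 * b * h2
  · simp only [← hab]
    linear_combination a * h2 - 2 * b * h1

lemma sq_emod_six {p : ℤ} (hp : p % 6 = 1 ∨ p % 6 = 5) : p ^ 2 % 6 = 1 := by
  rcases hp with h | h <;> simp [pow_two, Int.mul_emod, h]

lemma mul_emod_six {a : ℤ} (ha : a % 6 = 1) (x : ℤ) : (a * x) % 6 = x % 6 := by
  simp [Int.mul_emod, ha]

lemma image_twist {p a b : ℤ} (hp : p % 6 = 1 ∨ p % 6 = 5) (hab : a ^ 2 + 6 * b ^ 2 = p ^ 2)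
    (ha : a % 6 = 1) (hb : 6 ∣ b) (N : ℤ) :
    twist a b '' ellipsePoints N = {z ∈ ellipsePoints (p ^ 2 * N) |
      p ^ 2 ∣ a * z.1 + 3 * b * z.2 ∧ p ^ 2 ∣ a * z.2 - 2 * b * z.1} := by
  have hp2 := sq_emod_six hp
  have hp0 : p ^ 2 ≠ 0 := by intro h; simp [h] at hp2
  obtain ⟨c, rfl⟩ := hb
  ext ⟨x, y⟩
  constructor
  · rintro ⟨⟨u, v⟩, ⟨hu, hv, h⟩, huv⟩
    simp only [twist, Prod.mk.injEq] at huv hu hv h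
    obtain ⟨rfl, rfl⟩ := huv
    refine ⟨⟨?_, ?_, ?_⟩, ⟨u, ?_⟩, ⟨v, ?_⟩⟩
    · have h1 := mul_emod_six ha u
      have h2 : 3 * (6 * c) * v = 6 * (3 * c * v) := by ring
      simp only [h2]
      omega
    · have h1 := mul_emod_six ha v
      have h2 : 2 * (6 * c) * u = 6 * (2 * c * u) := by ring
      simp only [h2]
      omega
    · simp only [← h, ← hab]; ring
    · simp only [← hab]; ring
    · simp only [← hab]; ring
  · rintro ⟨⟨hx, hy, h⟩, ⟨u, hu⟩, ⟨v, hv⟩⟩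
    simp only at hx hy h hu hv
    refine ⟨(u, v), ⟨?_, ?_, ?_⟩, Prod.ext (mul_left_cancel₀ hp0 ?_) (mul_left_cancel₀ hp0 ?_)⟩
    · have h1 := mul_emod_six ha x
      have h2 : 3 * (6 * c) * y = 6 * (3 * c * y) := by ring
      have h3 := mul_emod_six hp2 u
      rw [h2] at hu
      simp only
      omega
    · have h1 := mul_emod_six ha y
      have h2 : 2 * (6 * c) * x = 6 * (2 * c * x) := by ring
      have h3 := mul_emod_six hp2 v
      rw [h2] at hv
      simp only
      omega
    · refine mul_left_cancel₀ (pow_ne_zero 2 hp0) ?_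
      simp only
      calc (p ^ 2) ^ 2 * (2 * u ^ 2 + 3 * v ^ 2) = 2 * (p ^ 2 * u) ^ 2 + 3 * (p ^ 2 * v) ^ 2 := by
            ring
        _ = p ^ 2 * (p ^ 2 * N) := by rw [← hu, ← hv, ← h, ← hab]; ring
        _ = _ := by ring
    · simp only [twist]
      linear_combination (-a) * hu + 3 * (6 * c) * hv + x * hab
    · simp only [twist]
      linear_combination (-a) * hv - 2 * (6 * c) * hu + y * hab

lemma isCoprime_six {p : ℤ} (hp : p % 6 = 1 ∨ p % 6 = 5) : IsCoprime p 6 := by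
  rcases hp with h | h
  · exact ⟨1, -(p / 6), by omega⟩
  · exact ⟨-1, p / 6 + 1, by omega⟩

lemma not_dvd_of_norm_eq_sq {p a b : ℤ} (hp : Prime p) (hp6 : p % 6 = 1 ∨ p % 6 = 5)
    (hab : a ^ 2 + 6 * b ^ 2 = p ^ 2) (hb : b ≠ 0) : ¬ p ∣ a ∧ ¬ p ∣ b := by
  have key : ¬ p ∣ b := by
    rintro ⟨c, rfl⟩
    have hc : c ≠ 0 := by rintro rfl; simp at hb
    have : 1 ≤ c ^ 2 := by have := sq_pos_of_ne_zero hc; omega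
    have : 0 < p ^ 2 := sq_pos_of_ne_zero hp.ne_zero
    nlinarith [sq_nonneg a]
  refine ⟨?_, key⟩
  rintro ⟨c, rfl⟩
  have h6 : p ∣ 6 * b ^ 2 := ⟨p - p * c ^ 2, by linear_combination hab⟩
  exact key (hp.dvd_of_dvd_pow ((isCoprime_six hp6).dvd_of_dvd_mul_left h6))

lemma dvd_iff_dvd_of_norm_eq_sq {p a b : ℤ} (hp6 : p % 6 = 1 ∨ p % 6 = 5)
    (hab : a ^ 2 + 6 * b ^ 2 = p ^ 2) (hpb : IsCoprime p b) {x y : ℤ}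
    (h : p ^ 2 ∣ a * x + 3 * b * y) : p ^ 2 ∣ a * y - 2 * b * x := by
  have h3b : IsCoprime (p ^ 2) (6 * b) := ((isCoprime_six hp6).mul_right hpb).pow_left
  refine h3b.dvd_of_dvd_mul_left ?_
  obtain ⟨k, hk⟩ := h
  exact ⟨2 * a * k - 2 * x, by linear_combination 2 * a * hk - 2 * x * hab⟩

lemma dvd_or_dvd_of_cube_dvd {p a b : ℤ} (hp : Prime p) (hp6 : p % 6 = 1 ∨ p % 6 = 5)
    (hab : a ^ 2 + 6 * b ^ 2 = p ^ 2) (hpa : IsCoprime p a) {x y : ℤ}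
    (h : p ^ 3 ∣ 2 * x ^ 2 + 3 * y ^ 2) :
    p ^ 2 ∣ a * x + 3 * b * y ∨ p ^ 2 ∣ a * x - 3 * b * y := by
  have hprod : ∀ {q u v : ℤ}, q ∣ p ^ 2 → q ∣ 2 * u ^ 2 + 3 * v ^ 2 →
      q ∣ (a * u + 3 * b * v) * (a * u - 3 * b * v) := by
    rintro q u v hq hq'
    have : (a * u + 3 * b * v) * (a * u - 3 * b * v)
      = p ^ 2 * u ^ 2 - (2 * u ^ 2 + 3 * v ^ 2) * (3 * b ^ 2) := by
        linear_combination u ^ 2 * hab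
    rw [this]
    exact dvd_sub (hq.mul_right _) (hq'.mul_right _)
  have h2 : p ^ 2 ∣ (a * x + 3 * b * y) * (a * x - 3 * b * y) :=
    hprod dvd_rfl ((pow_dvd_pow p (by norm_num)).trans h)
  by_cases h1 : p ∣ a * x + 3 * b * y
  swap
  · exact Or.inr (((hp.coprime_iff_not_dvd.mpr h1).pow_left).dvd_of_dvd_mul_left h2)
  by_cases h1' : p ∣ a * x - 3 * b * y
  swap
  · exact Or.inl (((hp.coprime_iff_not_dvd.mpr h1').pow_left).dvd_of_dvd_mul_right h2)
  have hx : p ∣ x := by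
    have : p ∣ 6 * (a * x) := by
      have := (dvd_add h1 h1').mul_left 3
      ring_nf at this ⊢
      exact this
    exact hpa.dvd_of_dvd_mul_left ((isCoprime_six hp6).dvd_of_dvd_mul_left this)
  obtain ⟨u, rfl⟩ := hx
  have hy : p ∣ y := by
    have h3 : p ∣ 6 * y ^ 2 := by
      have h4 := ((dvd_pow_self p three_ne_zero).trans h).mul_left 2
      have h5 : p ∣ 4 * (p * u) ^ 2 := ⟨4 * p * u ^ 2, by ring⟩
      have := dvd_sub h4 h5
      ring_nf at this ⊢
      exact this
    exact hp.dvd_of_dvd_pow ((isCoprime_six hp6).dvd_of_dvd_mul_left h3)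
  obtain ⟨v, rfl⟩ := hy
  have h3 : p ∣ 2 * u ^ 2 + 3 * v ^ 2 := by
    obtain ⟨k, hk⟩ := h
    exact ⟨k, mul_left_cancel₀ (pow_ne_zero 2 hp.ne_zero) (by linear_combination hk)⟩
  rcases hp.dvd_or_dvd (hprod (dvd_pow_self p two_ne_zero) h3) with ⟨k, hk⟩ | ⟨k, hk⟩
  · exact Or.inl ⟨k, by linear_combination p * hk⟩
  · exact Or.inr ⟨k, by linear_combination p * hk⟩

/-- A Hecke relation at a prime `p` splitting in `ℚ(√-6)`, for indices divisible by `p`. -/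
lemma ncard_ellipsePoints_sq_mul {p a b : ℤ} (hp : Prime p) (hp6 : p % 6 = 1 ∨ p % 6 = 5)
    (hab : a ^ 2 + 6 * b ^ 2 = p ^ 2) (ha : a % 6 = 1) (hb : 6 ∣ b) (hb0 : b ≠ 0)
    {N : ℤ} (hN : p ∣ N) :
    (ellipsePoints (p ^ 2 * N)).ncard +
      {z ∈ ellipsePoints (p ^ 2 * N) | p ^ 2 ∣ z.1 ∧ p ^ 2 ∣ z.2}.ncard =
      2 * (ellipsePoints N).ncard := by
  obtain ⟨hpa, hpb⟩ := not_dvd_of_norm_eq_sq hp hp6 hab hb0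
  replace hpa := hp.coprime_iff_not_dvd.mpr hpa
  replace hpb := hp.coprime_iff_not_dvd.mpr hpb
  have hab' : a ^ 2 + 6 * (-b) ^ 2 = p ^ 2 := by rw [neg_sq, hab]
  have hunion : twist a b '' ellipsePoints N ∪ twist a (-b) '' ellipsePoints N =
      ellipsePoints (p ^ 2 * N) := by
    rw [image_twist hp6 hab ha hb, image_twist hp6 hab' ha (hb.neg_right)]
    refine Set.Subset.antisymm (Set.union_subset (Set.sep_subset _ _) (Set.sep_subset _ _)) ?_
    rintro ⟨x, y⟩ hz
    have h3 : p ^ 3 ∣ 2 * x ^ 2 + 3 * y ^ 2 := by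
      obtain ⟨k, rfl⟩ := hN
      exact ⟨k, by rw [hz.2.2]; ring⟩
    rcases dvd_or_dvd_of_cube_dvd hp hp6 hab hpa h3 with h | h
    · exact Or.inl ⟨hz, h, dvd_iff_dvd_of_norm_eq_sq hp6 hab hpb h⟩
    · have h' : p ^ 2 ∣ a * x + 3 * (-b) * y := by convert h using 1; ring
      exact Or.inr ⟨hz, h', dvd_iff_dvd_of_norm_eq_sq hp6 hab' hpb.neg_right h'⟩
  have hinter : twist a b '' ellipsePoints N ∩ twist a (-b) '' ellipsePoints N =
      {z ∈ ellipsePoints (p ^ 2 * N) | p ^ 2 ∣ z.1 ∧ p ^ 2 ∣ z.2} := by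
    rw [image_twist hp6 hab ha hb, image_twist hp6 hab' ha (hb.neg_right)]
    ext ⟨x, y⟩
    constructor
    · rintro ⟨⟨hz, h1, h2⟩, -, h3, h4⟩
      have h6 : IsCoprime (p ^ 2) (6 * a) := ((isCoprime_six hp6).mul_right hpa).pow_left
      refine ⟨hz, h6.dvd_of_dvd_mul_left ?_, h6.dvd_of_dvd_mul_left ?_⟩
      · have := (dvd_add h1 h3).mul_left 3
        ring_nf at this ⊢
        exact this
      · have := (dvd_add h2 h4).mul_left 3
        ring_nf at this ⊢
        exact this
    · rintro ⟨hz, h1, h2⟩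
      exact ⟨⟨hz, dvd_add (h1.mul_left _) (h2.mul_left _), dvd_sub (h2.mul_left _) (h1.mul_left _)⟩,
        hz, dvd_add (h1.mul_left _) (h2.mul_left _), dvd_sub (h2.mul_left _) (h1.mul_left _)⟩
  have := Set.ncard_union_add_ncard_inter (twist a b '' ellipsePoints N)
    (twist a (-b) '' ellipsePoints N) ((finite_ellipsePoints N).image _)
    ((finite_ellipsePoints N).image _)
  rw [hunion, hinter, Set.ncard_image_of_injective _ (twist_injective hp.ne_zero hab),
    Set.ncard_image_of_injective _ (twist_injective hp.ne_zero hab')] at this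
  rw [this, two_mul]

lemma sep_dvd_ellipsePoints_eq_empty {p N : ℤ} (hp : p ≠ 0) (hN : ¬ p ^ 2 ∣ N) :
    {z ∈ ellipsePoints (p ^ 2 * N) | p ^ 2 ∣ z.1 ∧ p ^ 2 ∣ z.2} = ∅ := by
  refine Set.eq_empty_iff_forall_notMem.mpr ?_
  rintro ⟨x, y⟩ ⟨⟨-, -, h⟩, ⟨u, hu⟩, ⟨v, hv⟩⟩
  simp only at h hu hv
  refine hN ⟨2 * u ^ 2 + 3 * v ^ 2, mul_left_cancel₀ (pow_ne_zero 2 hp) ?_⟩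
  rw [← h, hu, hv]
  ring

lemma ncard_sep_dvd_ellipsePoints {p : ℤ} (hp6 : p % 6 = 1 ∨ p % 6 = 5) (N : ℤ) :
    {z ∈ ellipsePoints (p ^ 2 * (p ^ 2 * N)) | p ^ 2 ∣ z.1 ∧ p ^ 2 ∣ z.2}.ncard =
      (ellipsePoints N).ncard := by
  have hp2 := sq_emod_six hp6
  have hp0 : p ^ 2 ≠ 0 := by intro h; simp [h] at hp2
  have hinj : Function.Injective fun z : ℤ × ℤ ↦ (p ^ 2 * z.1, p ^ 2 * z.2) := by
    rintro ⟨x, y⟩ ⟨u, v⟩ h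
    simp only [Prod.mk.injEq] at h
    exact Prod.ext (mul_left_cancel₀ hp0 h.1) (mul_left_cancel₀ hp0 h.2)
  rw [← Set.ncard_image_of_injective (ellipsePoints N) hinj]
  congr 1
  ext ⟨x, y⟩
  constructor
  · rintro ⟨⟨hx, hy, h⟩, ⟨u, hu⟩, ⟨v, hv⟩⟩
    simp only at hx hy h hu hv
    refine ⟨(u, v), ⟨?_, ?_, ?_⟩, by simp only [hu, hv]⟩
    · rwa [hu, mul_emod_six hp2] at hx
    · rwa [hv, mul_emod_six hp2] at hy
    · refine mul_left_cancel₀ (pow_ne_zero 2 hp0) ?_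
      rw [hu, hv] at h
      linear_combination h
  · rintro ⟨⟨u, v⟩, ⟨hu, hv, h⟩, huv⟩
    simp only [Prod.mk.injEq] at huv hu hv h
    obtain ⟨rfl, rfl⟩ := huv
    refine ⟨⟨?_, ?_, ?_⟩, dvd_mul_right _ _, dvd_mul_right _ _⟩
    · exact (mul_emod_six hp2 u).trans hu
    · exact (mul_emod_six hp2 v).trans hv
    · simp only [← h]; ring

lemma even_ncard_ellipsePoints_of_split {p a b : ℤ} (hp : Prime p) (hp6 : p % 6 = 1 ∨ p % 6 = 5)
    (hab : a ^ 2 + 6 * b ^ 2 = p ^ 2) (ha : a % 6 = 1) (hb : 6 ∣ b) (hb0 : b ≠ 0)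
    {M : ℤ} (hM : ¬ p ∣ M) (k : ℕ) : Even (ellipsePoints (p ^ (4 * k + 3) * M)).ncard := by
  induction k with
  | zero =>
    have h := ncard_ellipsePoints_sq_mul hp hp6 hab ha hb hb0 (dvd_mul_right p M)
    rw [sep_dvd_ellipsePoints_eq_empty hp.ne_zero, Set.ncard_empty, add_zero] at h
    · rw [show p ^ (4 * 0 + 3) * M = p ^ 2 * (p * M) by ring, h]
      exact even_two_mul _
    · rwa [sq, mul_dvd_mul_iff_left hp.ne_zero]
  | succ k ih =>
    have h := ncard_ellipsePoints_sq_mul hp hp6 hab ha hb hb0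
      (N := p ^ 2 * (p ^ (4 * k + 3) * M)) ⟨p * (p ^ (4 * k + 3) * M), by ring⟩
    rw [ncard_sep_dvd_ellipsePoints hp6] at h
    rw [show p ^ (4 * (k + 1) + 3) * M = p ^ 2 * (p ^ 2 * (p ^ (4 * k + 3) * M)) by ring]
    grind

lemma two_mul_sq_add_three_mul_sq_ne_of_inert {p : ℤ} (hp : Prime p)
    (hin : ∀ x y : ℤ, p ∣ 2 * x ^ 2 + 3 * y ^ 2 → p ∣ x ∧ p ∣ y) {M : ℤ} (hM : ¬ p ∣ M) (j : ℕ)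
    (x y : ℤ) : 2 * x ^ 2 + 3 * y ^ 2 ≠ p ^ (2 * j + 1) * M := by
  intro h
  obtain ⟨⟨u, rfl⟩, ⟨v, rfl⟩⟩ := hin x y ⟨p ^ (2 * j) * M, by rw [h]; ring⟩
  induction j generalizing u v with
  | zero =>
    exact hM ⟨2 * u ^ 2 + 3 * v ^ 2, mul_left_cancel₀ hp.ne_zero (by linear_combination -h)⟩
  | succ j ih =>
    have h' : 2 * u ^ 2 + 3 * v ^ 2 = p ^ (2 * j + 1) * M :=
      mul_left_cancel₀ (pow_ne_zero 2 hp.ne_zero) (by linear_combination h)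
    obtain ⟨⟨u, rfl⟩, ⟨v, rfl⟩⟩ := hin u v ⟨p ^ (2 * j) * M, by rw [h']; ring⟩
    exact ih u v h'

lemma dvd_and_dvd_of_not_isSquare {p : ℕ} (hp : p.Prime) (hp6 : (p : ℤ) % 6 = 1 ∨ (p : ℤ) % 6 = 5)
    (hsq : ¬ IsSquare ((-6 : ℤ) : ZMod p)) {x y : ℤ} (h : (p : ℤ) ∣ 2 * x ^ 2 + 3 * y ^ 2) :
    (p : ℤ) ∣ x ∧ (p : ℤ) ∣ y := by
  have : Fact p.Prime := ⟨hp⟩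
  have hy : (p : ℤ) ∣ y := by
    by_contra hy
    rw [← ZMod.intCast_zmod_eq_zero_iff_dvd] at hy
    rw [← ZMod.intCast_zmod_eq_zero_iff_dvd] at h
    push_cast at h
    refine hsq ⟨2 * x / y, ?_⟩
    push_cast
    field_simp
    linear_combination (-2) * h
  refine ⟨?_, hy⟩
  obtain ⟨v, rfl⟩ := hy
  have h3 : (p : ℤ) ∣ 6 * x ^ 2 := by
    have := dvd_sub (h.mul_left 3) (⟨9 * p * v ^ 2, by ring⟩ : (p : ℤ) ∣ 9 * (p * v) ^ 2)
    ring_nf at this ⊢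
    exact this
  exact (Nat.prime_iff_prime_int.mp hp).dvd_of_dvd_pow
    ((isCoprime_six hp6).dvd_of_dvd_mul_left h3)

/-- Thue's lemma. -/
lemma exists_small_of_sqrt {p : ℕ} (hp : p.Prime) (t : ZMod p) :
    ∃ x y : ℤ, (x ≠ 0 ∨ y ≠ 0) ∧ x ^ 2 < p ∧ y ^ 2 < p ∧ (x : ZMod p) = t * y := by
  have : Fact p.Prime := ⟨hp⟩
  set s := Nat.sqrt p
  have hs : s ^ 2 < p := by
    refine lt_of_le_of_ne (Nat.sqrt_le' p) fun h ↦ ?_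
    exact Nat.Prime.not_prime_pow le_rfl (h ▸ hp)
  have hcard : (Finset.univ : Finset (ZMod p)).card <
      (Finset.range (s + 1) ×ˢ Finset.range (s + 1)).card := by
    rw [Finset.card_univ, ZMod.card, Finset.card_product, Finset.card_range]
    exact Nat.lt_succ_sqrt p
  obtain ⟨⟨a, b⟩, hab, ⟨c, d⟩, hcd, hne, heq⟩ := Finset.exists_ne_map_eq_of_card_lt_of_maps_to hcard
    (f := fun z : ℕ × ℕ ↦ (z.1 : ZMod p) - t * z.2) (fun _ _ ↦ Finset.mem_coe.mpr (Finset.mem_univ _))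
  simp only [Finset.mem_product, Finset.mem_range] at hab hcd
  have hbound : ∀ u v : ℕ, u < s + 1 → v < s + 1 → ((u : ℤ) - v) ^ 2 < p := by
    intro u v hu hv
    have h1 : ((u : ℤ) - v) ^ 2 ≤ (s : ℤ) ^ 2 := sq_le_sq' (by omega) (by omega)
    exact_mod_cast h1.trans_lt (by exact_mod_cast hs)
  refine ⟨a - c, b - d, ?_, hbound _ _ hab.1 hcd.1, hbound _ _ hab.2 hcd.2, ?_⟩
  · by_contra! h
    exact hne (Prod.ext (by have := h.1; simp only; omega) (by have := h.2; simp only; omega))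
  · simp only at heq
    push_cast
    linear_combination heq

lemma exists_form_eq {p : ℕ} (hp : p.Prime) (hsq : IsSquare ((-6 : ℤ) : ZMod p)) :
    (∃ x y : ℤ, x ^ 2 + 6 * y ^ 2 = p) ∨ ∃ x y : ℤ, 2 * x ^ 2 + 3 * y ^ 2 = p := by
  obtain ⟨t, ht⟩ := hsq
  obtain ⟨x, y, hxy, hx, hy, hmod⟩ := exists_small_of_sqrt hp t
  have hdvd : (p : ℤ) ∣ x ^ 2 + 6 * y ^ 2 := by
    rw [← ZMod.intCast_zmod_eq_zero_iff_dvd]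
    push_cast at ht ⊢
    rw [hmod]
    linear_combination (-(y : ZMod p) ^ 2) * ht
  obtain ⟨k, hk⟩ := hdvd
  have hp0 : (0 : ℤ) < p := by exact_mod_cast hp.pos
  have hk0 : 0 < k := by
    have : 0 < x ^ 2 + 6 * y ^ 2 := by
      rcases hxy with h | h
      · nlinarith [sq_pos_of_ne_zero h, sq_nonneg y]
      · nlinarith [sq_pos_of_ne_zero h, sq_nonneg x]
    rw [hk] at this
    exact pos_of_mul_pos_right this hp0.le
  have hk7 : k < 7 := by nlinarith
  have even_of : ∀ z : ℤ, z ^ 2 % 2 = 0 → ∃ w, z = 2 * w := fun z hz ↦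
    (Int.prime_two.dvd_of_dvd_pow (Int.dvd_of_emod_eq_zero hz))
  have three_of : ∀ z : ℤ, z ^ 2 % 3 = 0 → ∃ w, z = 3 * w := fun z hz ↦
    (Int.prime_three.dvd_of_dvd_pow (Int.dvd_of_emod_eq_zero hz))
  interval_cases k
  · exact Or.inl ⟨x, y, by linarith⟩
  · obtain ⟨u, rfl⟩ := even_of x (by omega)
    exact Or.inr ⟨u, y, by linarith⟩
  · obtain ⟨u, rfl⟩ := three_of x (by omega)
    exact Or.inr ⟨y, u, by linarith⟩
  · obtain ⟨u, rfl⟩ := even_of x (by omega)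
    obtain ⟨v, rfl⟩ := even_of y (by ring_nf at hk; omega)
    exact Or.inl ⟨u, v, by linarith⟩
  · have h5 : (5 : ℤ) ∣ (x - 2 * y) * (x + 2 * y) := ⟨p - 2 * y ^ 2, by linear_combination hk⟩
    rcases (by norm_num : Prime (5 : ℤ)).dvd_or_dvd h5 with ⟨u, hu⟩ | ⟨u, hu⟩
    · obtain rfl : x = 5 * u + 2 * y := by linarith
      exact Or.inr ⟨u + y, u, by linarith⟩
    · obtain rfl : x = 5 * u - 2 * y := by linarith
      exact Or.inr ⟨u - y, u, by linarith⟩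
  · obtain ⟨u, rfl⟩ := even_of x (by omega)
    obtain ⟨v, rfl⟩ := three_of u (by ring_nf at hk; omega)
    exact Or.inl ⟨y, v, by linarith⟩

lemma exists_norm_eq_sq {p : ℕ} (hp : p.Prime) (hp6 : (p : ℤ) % 6 = 1 ∨ (p : ℤ) % 6 = 5)
    (hsq : IsSquare ((-6 : ℤ) : ZMod p)) :
    ∃ a b : ℤ, a ^ 2 + 6 * b ^ 2 = (p : ℤ) ^ 2 ∧ b ≠ 0 := by
  rcases exists_form_eq hp hsq with ⟨r, s, h⟩ | ⟨r, s, h⟩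
  · refine ⟨r ^ 2 - 6 * s ^ 2, 2 * r * s, by rw [← h]; ring, ?_⟩
    refine mul_ne_zero (mul_ne_zero two_ne_zero ?_) ?_
    · rintro rfl; omega
    · rintro rfl
      exact (Nat.prime_iff_prime_int.mp hp).irreducible.not_isSquare ⟨r, by rw [← h]; ring⟩
  · refine ⟨2 * r ^ 2 - 3 * s ^ 2, 2 * r * s, by rw [← h]; ring, ?_⟩
    refine mul_ne_zero (mul_ne_zero two_ne_zero ?_) ?_
    · rintro rfl; omega
    · rintro rfl; omega

lemma exists_normalized_norm_eq_sq {p : ℕ} (hp : p.Prime)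
    (hp6 : (p : ℤ) % 6 = 1 ∨ (p : ℤ) % 6 = 5) (hsq : IsSquare ((-6 : ℤ) : ZMod p)) :
    ∃ a b : ℤ, a ^ 2 + 6 * b ^ 2 = (p : ℤ) ^ 2 ∧ b ≠ 0 ∧ a % 6 = 1 ∧ (b % 6 = 0 ∨ b % 6 = 4) := by
  obtain ⟨a, b, hab, hb⟩ := exists_norm_eq_sq hp hp6 hsq
  have hp2 := sq_emod_six hp6
  have ha6 : a % 6 = 1 ∨ a % 6 = 5 := by
    have h1 : a ^ 2 % 6 = 1 := by omega
    have h2 := Int.emod_nonneg a (by norm_num : (6 : ℤ) ≠ 0)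
    have h3 := Int.emod_lt_of_pos a (by norm_num : (0 : ℤ) < 6)
    interval_cases h : a % 6 <;> simp_all [pow_two, Int.mul_emod]
  have hb2 : b % 2 = 0 := by
    have sq8 : ∀ z : ℤ, z % 6 = 1 ∨ z % 6 = 5 → z ^ 2 % 8 = 1 := by
      intro z hz
      have : z % 8 = 1 ∨ z % 8 = 3 ∨ z % 8 = 5 ∨ z % 8 = 7 := by omega
      rcases this with h | h | h | h <;> simp [pow_two, Int.mul_emod, h]
    have h1 := sq8 a ha6
    have h2 := sq8 p hp6
    rcases Int.emod_two_eq_zero_or_one b with h | h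
    · exact h
    · have : b ^ 2 % 2 = 1 := by simp [pow_two, Int.mul_emod, h]
      omega
  obtain ⟨a', ha', ha''⟩ : ∃ a', a' ^ 2 = a ^ 2 ∧ a' % 6 = 1 := by
    rcases ha6 with h | h
    · exact ⟨a, rfl, h⟩
    · exact ⟨-a, neg_sq a, by omega⟩
  obtain ⟨b', hb', hb''⟩ : ∃ b', b' ^ 2 = b ^ 2 ∧ (b' % 6 = 0 ∨ b' % 6 = 4) := by
    by_cases h : b % 6 = 2
    · exact ⟨-b, neg_sq b, by omega⟩
    · exact ⟨b, rfl, by omega⟩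
  refine ⟨a', b', by rw [ha', hb', hab], ?_, ha'', hb''⟩
  rintro rfl
  exact hb (by simpa using hb'.symm)

lemma sq_eq_sq_of_norm_eq_sq {p a b c d : ℤ} (hp : Prime p) (hp6 : p % 6 = 1 ∨ p % 6 = 5)
    (hab : a ^ 2 + 6 * b ^ 2 = p ^ 2) (hcd : c ^ 2 + 6 * d ^ 2 = p ^ 2) (hb : b ≠ 0) (hd : d ≠ 0) :
    a ^ 2 = c ^ 2 ∧ b ^ 2 = d ^ 2 := by
  obtain ⟨hpa, -⟩ := not_dvd_of_norm_eq_sq hp hp6 hab hb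
  obtain ⟨-, hpd⟩ := not_dvd_of_norm_eq_sq hp hp6 hcd hd
  have hp2 : 0 < p ^ 2 := sq_pos_of_ne_zero hp.ne_zero
  have hprod : (a * d - c * b) * (a * d + c * b) = p ^ 2 * (d ^ 2 - b ^ 2) := by
    linear_combination d ^ 2 * hab - b ^ 2 * hcd
  have small : ∀ u v : ℤ, v ^ 2 + 6 * u ^ 2 = p ^ 2 * p ^ 2 → p ^ 2 ∣ u → u = 0 := by
    rintro u v h ⟨w, rfl⟩
    by_contra hw
    have : w ≠ 0 := by rintro rfl; simp at hw
    have : 0 < w ^ 2 := sq_pos_of_ne_zero this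
    nlinarith [sq_nonneg v, mul_pos hp2 hp2]
  have hzero : (a * d - c * b) * (a * d + c * b) = 0 := by
    have hdvd : p ^ 2 ∣ (a * d - c * b) * (a * d + c * b) := ⟨_, hprod⟩
    by_cases h1 : p ∣ a * d - c * b
    · have h2 : ¬ p ∣ a * d + c * b := by
        intro h2
        have h3 : p ∣ 6 * (a * d) := by
          have := (dvd_add h1 h2).mul_left 3
          ring_nf at this ⊢
          exact this
        rcases hp.dvd_or_dvd ((isCoprime_six hp6).dvd_of_dvd_mul_left h3) with h | h
        · exact hpa h
        · exact hpd h
      have h4 := ((hp.coprime_iff_not_dvd.mpr h2).pow_left).dvd_of_dvd_mul_right hdvd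
      rw [small _ (a * c + 6 * b * d) ?_ h4, zero_mul]
      nth_rw 1 [← hab]
      rw [← hcd]; ring
    · have h4 := ((hp.coprime_iff_not_dvd.mpr h1).pow_left).dvd_of_dvd_mul_left hdvd
      rw [small _ (a * c - 6 * b * d) ?_ h4, mul_zero]
      nth_rw 1 [← hab]
      rw [← hcd]; ring
  rw [hzero, eq_comm, mul_eq_zero] at hprod
  have : d ^ 2 - b ^ 2 = 0 := hprod.resolve_left hp2.ne'
  constructor <;> linarith

lemma exists_norm_eq_sq_of_odd {p : ℕ} (hp : p.Prime) (hp5 : p ≠ 5)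
    (hp6 : (p : ℤ) % 6 = 1 ∨ (p : ℤ) % 6 = 5) (hsq : IsSquare ((-6 : ℤ) : ZMod p))
    (hodd : Odd (ellipsePoints (5 * (p : ℤ) ^ 2)).ncard) :
    ∃ a b : ℤ, a ^ 2 + 6 * b ^ 2 = (p : ℤ) ^ 2 ∧ b ≠ 0 ∧ a % 6 = 1 ∧ 6 ∣ b := by
  by_contra! hno
  have hpp := Nat.prime_iff_prime_int.mp hp
  obtain ⟨a, b, hab, hb, ha6, hb6⟩ := exists_normalized_norm_eq_sq hp hp6 hsq
  replace hb6 : b % 6 = 4 := hb6.resolve_left fun h ↦ hno a b hab hb ha6 (Int.dvd_of_emod_eq_zero h)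
  obtain ⟨q, hq, hq6⟩ : ∃ q : ℤ, q ^ 2 = (p : ℤ) ^ 2 ∧ q % 6 = 1 := by
    rcases hp6 with h | h
    · exact ⟨p, rfl, h⟩
    · exact ⟨-p, neg_sq _, by omega⟩
  have eq_of_sq : ∀ {u v : ℤ}, u ^ 2 = v ^ 2 → (u % 6 = 1 ∧ v % 6 = 1) ∨ (u % 6 = 4 ∧ v % 6 = 4) →
      u = v := by
    intro u v h h6
    rcases sq_eq_sq_iff_eq_or_eq_neg.mp h with h | h <;> omega
  have hset : ellipsePoints (5 * (p : ℤ) ^ 2) = {(q, q), (a + 3 * b, -a + 2 * b)} := by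
    ext ⟨x, y⟩
    simp only [ellipsePoints, Set.mem_ofPred_eq, Set.mem_insert_iff, Set.mem_singleton_iff,
      Prod.mk.injEq]
    constructor
    · rintro ⟨hx, hy, h⟩
      have h5 : (5 : ℤ) ∣ (y - x) * (x + y) :=
        ⟨2 * ((p : ℤ) ^ 2 - x ^ 2) - (y ^ 2 - x ^ 2), by linear_combination 2 * h⟩
      rcases (by norm_num : Prime (5 : ℤ)).dvd_or_dvd h5 with ⟨d, hd⟩ | ⟨d, hd⟩
      · left
        obtain rfl : y = x + 5 * d := by linarith
        have hnorm : (x + 3 * d) ^ 2 + 6 * d ^ 2 = (p : ℤ) ^ 2 := by linarith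
        obtain rfl : d = 0 := by
          by_contra hd0
          exact hno _ _ hnorm hd0 (by omega) (by omega)
        have : x = q := eq_of_sq (by linarith) (by omega)
        omega
      · right
        obtain rfl : y = 5 * d - x := by linarith
        have hnorm : (x - 3 * d) ^ 2 + 6 * d ^ 2 = (p : ℤ) ^ 2 := by linarith
        obtain ⟨h1, h2⟩ := sq_eq_sq_of_norm_eq_sq hpp hp6 hnorm hab (by omega) hb
        have h3 : x - 3 * d = a := eq_of_sq h1 (by omega)
        have h4 : d = b := eq_of_sq h2 (by omega)
        omega
    · rintro (⟨rfl, rfl⟩ | ⟨rfl, rfl⟩)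
      · exact ⟨hq6, hq6, by linarith⟩
      · exact ⟨by omega, by omega, by linarith⟩
  rw [hset, Set.ncard_pair] at hodd
  · exact absurd hodd (by decide)
  · intro h
    simp only [Prod.mk.injEq] at h
    obtain rfl : b = -2 * a := by linarith
    have h5 : (5 : ℤ) ∣ p :=
      (by norm_num : Prime (5 : ℤ)).dvd_of_dvd_pow (n := 2) ⟨5 * a ^ 2, by linarith⟩
    exact hp5 ((Nat.prime_dvd_prime_iff_eq Nat.prime_five hp).mp (by exact_mod_cast h5)).symm

section GeneratingFunctions

open PowerSeries PowerSeries.WithPiTopology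

lemma hasProd_one_sub_X_pow_mul {d : ℕ} (hd : d ≠ 0) :
    HasProd (fun i ↦ (1 - X ^ (d * (i + 1)) : (ZMod 2)⟦X⟧))
      (expand d hd (pentagonalSeries (ZMod 2))) := by
  have h := hasProd_one_sub_X_pow (ZMod 2)
  rw [HasProd, tendsto_iff_coeff_tendsto] at h ⊢
  intro n
  have hprod : ∀ s : Finset ℕ, ∏ i ∈ s, (1 - X ^ (d * (i + 1)) : (ZMod 2)⟦X⟧) =
      expand d hd (∏ i ∈ s, (1 - X ^ (i + 1))) := by
    intro s
    simp [map_prod, pow_mul]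
  simp only [hprod, coeff_expand]
  split_ifs
  · exact h _
  · exact tendsto_const_nhds

/-- The reduction modulo `2` of `∏ (1 - q^k)^2 (1 - q^{3k})`. -/
noncomputable def thetaProduct : (ZMod 2)⟦X⟧ :=
  expand 2 two_ne_zero (pentagonalSeries (ZMod 2)) *
    expand 3 three_ne_zero (pentagonalSeries (ZMod 2))

lemma two_eq_zero_zmod_two : (2 : (ZMod 2)⟦X⟧) = 0 := by
  rw [← map_ofNat (C (R := ZMod 2)) 2, show (OfNat.ofNat 2 : ZMod 2) = 0 from rfl, map_zero]

lemma hasProd_thetaProduct :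
    HasProd (fun i ↦ ((1 - X ^ (i + 1)) ^ 2 * (1 - X ^ (3 * (i + 1))) : (ZMod 2)⟦X⟧))
      thetaProduct := by
  convert! (hasProd_one_sub_X_pow_mul two_ne_zero).mul (hasProd_one_sub_X_pow_mul three_ne_zero)
    using 3 with i
  linear_combination (X ^ (2 * (i + 1)) - X ^ (i + 1)) * two_eq_zero_zmod_two

lemma regularPartitionCount_eq (t n : ℕ) (ht : 0 < t) :
    regularPartitionCount t n = (Nat.Partition.countRestricted n t).card := by
  rw [← Nat.Partition.card_restricted_eq_card_countRestricted n ht, regularPartitionCount,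
    Nat.card_eq_fintype_card, Fintype.card_subtype]
  rfl

lemma cast_B_four_three (n : ℕ) : (B 4 3 n : ZMod 2) = coeff n thetaProduct := by
  have h4 := Nat.Partition.hasProd_powerSeriesMk_card_countRestricted (ZMod 2) (m := 4) (by norm_num)
  have h3 := Nat.Partition.hasProd_powerSeriesMk_card_countRestricted (ZMod 2) (m := 3) (by norm_num)
  have h := (h4.mul h3).unique (by
    convert! hasProd_thetaProduct using 2 with i
    simp only [Finset.sum_range_succ, Finset.sum_range_zero]
    linear_combination (2 * X ^ (i + 1) - X ^ (2 * (i + 1)) + X ^ (3 * (i + 1))) *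
      (1 + X ^ (i + 1) + X ^ (2 * (i + 1))) * two_eq_zero_zmod_two)
  rw [← h, coeff_mul, Finset.Nat.sum_antidiagonal_eq_sum_range_succ_mk]
  simp [B, regularPartitionCount_eq]

lemma coeff_eq_coeff_prod_range {R : Type*} [CommRing R] [TopologicalSpace R] [DiscreteTopology R]
    {f : ℕ → R⟦X⟧} {g : R⟦X⟧} (h : HasProd f g) (hf : ∀ i, X ^ (i + 1) ∣ f i - 1) (n : ℕ) :
    coeff n g = coeff n (∏ i ∈ Finset.range n, f i) := by
  rw [HasProd, tendsto_iff_coeff_tendsto] at h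
  have h := h n
  rw [nhds_discrete, Filter.tendsto_pure] at h
  obtain ⟨s, hs, hsub⟩ := (h.and (Filter.eventually_ge_atTop (Finset.range n))).exists
  rw [← hs, ← Finset.prod_sdiff hsub]
  have hone : X ^ (n + 1) ∣ ∏ i ∈ s \ Finset.range n, f i - 1 := by
    refine Finset.prod_induction f (fun u ↦ X ^ (n + 1) ∣ u - 1) ?_ (by simp) ?_
    · intro u v hu hv
      rw [show u * v - 1 = (u - 1) * v + (v - 1) by ring]
      exact dvd_add (hu.mul_right _) hv
    · intro i hi
      simp only [Finset.mem_sdiff, Finset.mem_range, not_lt] at hi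
      exact (pow_dvd_pow X (by omega)).trans (hf i)
  rw [← sub_eq_zero, ← map_sub, ← sub_one_mul]
  exact X_pow_dvd_iff.mp (hone.mul_right _) n n.lt_succ_self

lemma cast_a1 (n : ℕ) : (a1 n : ZMod 2) = coeff n thetaProduct := by
  rw [coeff_eq_coeff_prod_range hasProd_thetaProduct, a1, ← eq_intCast (Int.castRingHom (ZMod 2)),
    ← Polynomial.coeff_coe, ← PowerSeries.coeff_map, Finset.range_eq_Ico,
    Finset.prod_Ico_add' (fun i ↦ ((1 - X ^ i) ^ 2 * (1 - X ^ (3 * i)) : (ZMod 2)⟦X⟧)) 0 n 1]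
  · rw [← Polynomial.coeToPowerSeries.ringHom_apply]
    simp [map_prod, Finset.Ico_add_one_right_eq_Icc]
  · intro i
    have h1 : (X ^ (i + 1) : (ZMod 2)⟦X⟧) ∣ X ^ (3 * (i + 1)) := pow_dvd_pow X (by omega)
    rw [show ((1 - X ^ (i + 1)) ^ 2 * (1 - X ^ (3 * (i + 1))) - 1 : (ZMod 2)⟦X⟧) =
      X ^ (i + 1) * (X ^ (i + 1) - 2) - (1 - X ^ (i + 1)) ^ 2 * X ^ (3 * (i + 1)) by ring]
    exact dvd_sub (dvd_mul_right _ _) (h1.mul_left _)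

lemma coeff_pentagonalSeries_zmod_two (n : ℕ) [Decidable (n ∈ Set.range pentagonal)] :
    coeff n (pentagonalSeries (ZMod 2)) = if n ∈ Set.range pentagonal then 1 else 0 := by
  split_ifs with h
  · obtain ⟨k, rfl⟩ := h
    rw [coeff_pentagonalSeries_pentagonal]
    rcases Int.even_or_odd k with h | h <;> simp [Int.negOnePow_even, Int.negOnePow_odd, h]
  · exact coeff_pentagonalSeries_eq_zero _ h

open Classical in
lemma coeff_expand_pentagonalSeries {d : ℕ} (hd : d ≠ 0) (n : ℕ) :
    coeff n (expand d hd (pentagonalSeries (ZMod 2))) =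
      if ∃ k, n = d * pentagonal k then 1 else 0 := by
  rw [coeff_expand, coeff_pentagonalSeries_zmod_two, ← ite_and]
  congr 1
  refine propext ⟨?_, ?_⟩
  · rintro ⟨⟨m, rfl⟩, k, hk⟩
    rw [Nat.mul_div_cancel_left _ (Nat.pos_of_ne_zero hd)] at hk
    exact ⟨k, by rw [hk]⟩
  · rintro ⟨k, rfl⟩
    exact ⟨dvd_mul_right _ _, k, by rw [Nat.mul_div_cancel_left _ (Nat.pos_of_ne_zero hd)]⟩

lemma sq_eq_pentagonal {x : ℤ} (hx : x % 6 = 1) :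
    x ^ 2 = 24 * (pentagonal ((1 - x) / 6) : ℤ) + 1 := by
  have h := two_mul_natCast_pentagonal ((1 - x) / 6)
  obtain ⟨k, hk⟩ : ∃ k, x = 1 - 6 * k := ⟨(1 - x) / 6, by omega⟩
  rw [show (1 - x) / 6 = k by omega] at h ⊢
  subst hk
  linear_combination (-12) * h

lemma coeff_thetaProduct (n : ℕ) :
    coeff n thetaProduct = ((ellipsePoints (24 * n + 5)).ncard : ZMod 2) := by
  classical
  rw [thetaProduct, coeff_mul]
  simp only [coeff_expand_pentagonalSeries, ite_zero_mul_ite_zero, mul_one, Finset.sum_boole]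
  congr 1
  rw [← Set.ncard_coe_finset]
  have hinj : Set.InjOn (fun z : ℤ × ℤ ↦
      (2 * pentagonal ((1 - z.1) / 6), 3 * pentagonal ((1 - z.2) / 6)))
      (ellipsePoints (24 * n + 5)) := by
    rintro ⟨x, y⟩ ⟨hx, hy, -⟩ ⟨u, v⟩ ⟨hu, hv, -⟩ h
    simp only [Prod.mk.injEq, mul_eq_mul_left_iff, pentagonal_inj] at h hx hy hu hv
    ext <;> simp only <;> omega
  rw [← hinj.ncard_image]
  congr 1
  ext ⟨i, j⟩
  simp only [Finset.coe_filter, Finset.HasAntidiagonal.mem_antidiagonal, Set.mem_ofPred_eq, Set.mem_image,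
    Prod.mk.injEq, Prod.exists]
  constructor
  · rintro ⟨h, ⟨k, rfl⟩, l, rfl⟩
    have hk : (1 - (1 - 6 * k)) / 6 = k := by omega
    have hl : (1 - (1 - 6 * l)) / 6 = l := by omega
    have h1 := sq_eq_pentagonal (x := 1 - 6 * k) (by omega)
    have h2 := sq_eq_pentagonal (x := 1 - 6 * l) (by omega)
    rw [hk] at h1
    rw [hl] at h2
    refine ⟨1 - 6 * k, 1 - 6 * l, ⟨by simp only; omega, by simp only; omega, ?_⟩,
      by rw [hk], by rw [hl]⟩
    simp only [h1, h2]
    omega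
  · rintro ⟨x, y, ⟨hx, hy, h⟩, rfl, rfl⟩
    simp only at hx hy h
    rw [sq_eq_pentagonal hx, sq_eq_pentagonal hy] at h
    exact ⟨by omega, ⟨_, rfl⟩, _, rfl⟩

end GeneratingFunctions

lemma sq_mod_twentyFour {p : ℕ} (hp6 : (p : ℤ) % 6 = 1 ∨ (p : ℤ) % 6 = 5) : p ^ 2 % 24 = 1 := by
  have : p % 24 = 1 ∨ p % 24 = 5 ∨ p % 24 = 7 ∨ p % 24 = 11 ∨ p % 24 = 13 ∨ p % 24 = 17 ∨
    p % 24 = 19 ∨ p % 24 = 23 := by omega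
  rcases this with h | h | h | h | h | h | h | h <;> simp [pow_two, Nat.mul_mod, h]

lemma ncard_ellipsePoints_five_mul_five_sq : (ellipsePoints (5 * 5 ^ 2)).ncard = 1 := by
  rw [Set.ncard_eq_one]
  refine ⟨(-5, -5), Set.Subset.antisymm ?_ ?_⟩
  · rintro ⟨x, y⟩ ⟨hx, hy, h⟩
    simp only at hx hy h
    have hx1 : -8 < x := by nlinarith
    have hx2 : x < 8 := by nlinarith
    have hy1 : -7 < y := by nlinarith
    have hy2 : y < 7 := by nlinarith
    obtain rfl | rfl | rfl : x = -5 ∨ x = 1 ∨ x = 7 := by omega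
    all_goals
      obtain rfl | rfl : y = -5 ∨ y = 1 := by omega
      all_goals simp at h ⊢
  · rintro _ rfl
    exact ⟨by norm_num, by norm_num, by norm_num⟩

lemma odd_of_w1_even {p : ℕ} (hp : p.Prime) (hp6 : (p : ℤ) % 6 = 1 ∨ (p : ℤ) % 6 = 5)
    (hw : w1 p hp ≡ 0 [ZMOD 2]) :
    p ≠ 5 ∧ Odd (ellipsePoints (5 * (p : ℤ) ^ 2)).ncard := by
  have : Fact p.Prime := ⟨hp⟩
  obtain ⟨m, hm⟩ : ∃ m, p ^ 2 = 24 * m + 1 := by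
    have h1 := sq_mod_twentyFour hp6
    exact ⟨p ^ 2 / 24, by omega⟩
  have hm5 : 5 * (p ^ 2 - 1) / 24 = 5 * m := by omega
  have hm' : (p : ℤ) ^ 2 = 24 * m + 1 := by exact_mod_cast hm
  have hcard : (a1 (5 * m) : ZMod 2) = ((ellipsePoints (5 * (p : ℤ) ^ 2)).ncard : ZMod 2) := by
    rw [cast_a1, coeff_thetaProduct]
    congr 3
    push_cast
    linarith
  rw [w1, hm5] at hw
  replace hw := (ZMod.intCast_eq_intCast_iff _ _ 2).mpr hw
  push_cast at hw
  rw [hcard] at hw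
  have hne : p ≠ 5 := by
    rintro rfl
    have h5 : m = 1 := by omega
    subst h5
    have : legendreSym 5 (-(5 * (1 : ℤ))) = 0 :=
      (legendreSym.eq_zero_iff 5 _).mpr ((ZMod.intCast_zmod_eq_zero_iff_dvd _ 5).mpr (by norm_num))
    rw [Nat.cast_one, this, Nat.cast_ofNat, ncard_ellipsePoints_five_mul_five_sq] at hw
    simp at hw
  refine ⟨hne, ?_⟩
  have hpp := Nat.prime_iff_prime_int.mp hp
  have h6 : ((-6 : ℤ) : ZMod p) ≠ 0 := by
    rw [Ne, ZMod.intCast_zmod_eq_zero_iff_dvd, dvd_neg]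
    intro h
    exact hpp.not_isUnit ((isCoprime_six hp6).isUnit_of_dvd' dvd_rfl h)
  have hm0 : ((-(5 * (m : ℤ)) : ℤ) : ZMod p) ≠ 0 := by
    rw [Ne, ZMod.intCast_zmod_eq_zero_iff_dvd, dvd_neg]
    intro h
    have h5 : (p : ℤ) ∣ 5 := by
      have := dvd_sub (dvd_mul_of_dvd_right (dvd_pow_self (p : ℤ) two_ne_zero) 5) (h.mul_left 24)
      rw [hm'] at this
      ring_nf at this
      exact this
    exact hne ((Nat.prime_dvd_prime_iff_eq hp Nat.prime_five).mp (by exact_mod_cast h5))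
  have hodd : ((ellipsePoints (5 * (p : ℤ) ^ 2)).ncard : ZMod 2) = 1 := by
    have e : ∀ c : ZMod 2, c + 1 = 0 → c = 1 := by decide
    rcases legendreSym.eq_one_or_neg_one p h6 with h | h <;>
      rcases legendreSym.eq_one_or_neg_one p hm0 with h' | h' <;>
      · rw [h, h'] at hw
        exact e _ (by simpa using hw)
  exact (ZMod.natCast_eq_one_iff_odd).mp hodd

lemma even_ncard_ellipsePoints {p : ℕ} (hp : p.Prime) (hp6 : (p : ℤ) % 6 = 1 ∨ (p : ℤ) % 6 = 5)
    (hw : w1 p hp ≡ 0 [ZMOD 2]) {M : ℤ} (hM : ¬ (p : ℤ) ∣ M) (k : ℕ) :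
    Even (ellipsePoints ((p : ℤ) ^ (4 * k + 3) * M)).ncard := by
  have hpp := Nat.prime_iff_prime_int.mp hp
  by_cases hsq : IsSquare ((-6 : ℤ) : ZMod p)
  · obtain ⟨hp5, hodd⟩ := odd_of_w1_even hp hp6 hw
    obtain ⟨a, b, hab, hb0, ha, hb⟩ := exists_norm_eq_sq_of_odd hp hp5 hp6 hsq hodd
    exact even_ncard_ellipsePoints_of_split hpp hp6 hab ha hb hb0 hM k
  · have hempty : ellipsePoints ((p : ℤ) ^ (4 * k + 3) * M) = ∅ := by
      refine Set.eq_empty_iff_forall_notMem.mpr fun z hz ↦ ?_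
      refine two_mul_sq_add_three_mul_sq_ne_of_inert hpp
        (fun x y ↦ dvd_and_dvd_of_not_isSquare hp hp6 hsq) hM (2 * k + 1) z.1 z.2 ?_
      rw [hz.2.2]
      ring_nf
    rw [hempty, Set.ncard_empty]
    exact Even.zero

/-- Theorem 1.8(i). -/
theorem B_4_3_cong_i (p : ℕ) (hp : p.Prime) (hp5 : 5 ≤ p)
    (hw : w1 p hp ≡ 0 [ZMOD 2]) (n k : ℕ) (hn : ¬ p ∣ n) :
    B 4 3 (p ^ (4 * k + 3) * n + 5 * (p ^ (4 * k + 4) - 1) / 24) ≡ 0 [MOD 2] := by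
  have hp6 : (p : ℤ) % 6 = 1 ∨ (p : ℤ) % 6 = 5 := by
    have h2 : p % 2 = 1 := hp.eq_two_or_odd.resolve_left (by omega)
    have h3 : ¬ 3 ∣ p := fun h ↦ by
      have := (Nat.prime_dvd_prime_iff_eq Nat.prime_three hp).mp h
      omega
    omega
  obtain ⟨m, hm⟩ : ∃ m, p ^ (4 * k + 4) = 24 * m + 1 := by
    have h1 := sq_mod_twentyFour hp6
    have h2 : p ^ (4 * k + 4) % 24 = 1 := by
      rw [show 4 * k + 4 = 2 * (2 * k + 2) by ring, pow_mul, Nat.pow_mod, h1, one_pow,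
        Nat.one_mod_eq_one.mpr (by norm_num)]
    exact ⟨p ^ (4 * k + 4) / 24, by omega⟩
  rw [show 5 * (p ^ (4 * k + 4) - 1) / 24 = 5 * m by omega]
  rw [← ZMod.natCast_eq_natCast_iff, cast_B_four_three, coeff_thetaProduct, Nat.cast_zero,
    ZMod.natCast_eq_zero_iff_even]
  have hM : ¬ (p : ℤ) ∣ 24 * n + 5 * p := by
    intro h
    have h24 : (p : ℤ) ∣ 6 ^ 3 * n := by
      have := ((dvd_add_left (dvd_mul_left (p : ℤ) 5)).mp h).mul_left 9
      ring_nf at this ⊢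
      exact this
    have := (isCoprime_six hp6).pow_right.dvd_of_dvd_mul_left h24
    exact hn (by exact_mod_cast this)
  have hN : (24 * ((p ^ (4 * k + 3) * n + 5 * m : ℕ) : ℤ) + 5) =
      (p : ℤ) ^ (4 * k + 3) * (24 * n + 5 * p) := by
    have hm' : (p : ℤ) ^ (4 * k + 4) = 24 * m + 1 := by exact_mod_cast hm
    push_cast
    linear_combination (-5) * hm'
  rw [hN]
  exact even_ncard_ellipsePoints hp hp6 hw hM k
end
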